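/- arXiv:1203.6675 — 10 statements merged into one kernel-verified Lean document; each statement's English description precedes it below -/
import Mathlib

section
/- Suppose Assumptions 1 and 2 hold. If x^S and x̄^S are both social optima of the Cournot oligopoly model (optimal solutions of the social welfare maximization problem), then they result in the same price: p(X^S) = p(X̄^S), where X^S and X̄^S are the respective aggregate supplies. -/
open Finset Set

noncomputable section

/-- Assumption 1: the cost function `C` (with derivative `C'`) is convex, continuous,
nondecreasing on `[0,∞)`, continuously differentiable on `(0,∞)`, has right derivative
`C' 0` at `0`, and `C 0 = 0`. -/
def CostAssumption (C C' : ℝ → ℝ) : Prop :=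
  ConvexOn ℝ (Set.Ici 0) C ∧
  ContinuousOn C (Set.Ici 0) ∧
  MonotoneOn C (Set.Ici 0) ∧
  (∀ x : ℝ, 0 < x → HasDerivAt C (C' x) x) ∧
  ContinuousOn C' (Set.Ioi 0) ∧
  HasDerivWithinAt C (C' 0) (Set.Ici 0) 0 ∧
  C 0 = 0

/-- Assumption 2: the inverse demand function `p` is continuous, nonnegative and
nonincreasing on `[0,∞)`, with `p 0 > 0`; `pr q` is the right derivative of `p`
at every `q ≥ 0` and `pl q` is the left derivative of `p` at every `q > 0`. -/
def DemandAssumption (p pl pr : ℝ → ℝ) : Prop :=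
  ContinuousOn p (Set.Ici 0) ∧
  (∀ q : ℝ, 0 ≤ q → 0 ≤ p q) ∧
  AntitoneOn p (Set.Ici 0) ∧
  0 < p 0 ∧
  HasDerivWithinAt p (pr 0) (Set.Ici 0) 0 ∧
  (∀ q : ℝ, 0 < q → HasDerivWithinAt p (pr q) (Set.Ici q) q) ∧
  (∀ q : ℝ, 0 < q → HasDerivWithinAt p (pl q) (Set.Iic q) q)

/-- The social welfare of the supply vector `x`. -/
def SW {N : ℕ} (C : Fin N → ℝ → ℝ) (p : ℝ → ℝ) (x : Fin N → ℝ) : ℝ :=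
  (∫ q in (0:ℝ)..(∑ n, x n), p q) - ∑ n, C n (x n)

/-- A social optimum: a nonnegative vector maximizing the social welfare. -/
def SocialOptimum {N : ℕ} (C : Fin N → ℝ → ℝ) (p : ℝ → ℝ) (x : Fin N → ℝ) : Prop :=
  (∀ n, 0 ≤ x n) ∧ ∀ y : Fin N → ℝ, (∀ n, 0 ≤ y n) → SW C p y ≤ SW C p x

/-- A Cournot candidate: a nonnegative vector satisfying the first-order necessary
conditions for a Cournot equilibrium. -/
def CournotCandidate {N : ℕ} (C' : Fin N → ℝ → ℝ) (p pl pr : ℝ → ℝ)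
    (x : Fin N → ℝ) : Prop :=
  (∀ n, 0 ≤ x n) ∧
  ∀ n, (0 < x n → C' n (x n) ≤ p (∑ m, x m) + x n * pl (∑ m, x m)) ∧
       p (∑ m, x m) + x n * pr (∑ m, x m) ≤ C' n (x n)

/-- A Cournot equilibrium: each supplier's quantity is a best response. -/
def CournotEquilibrium {N : ℕ} (C : Fin N → ℝ → ℝ) (p : ℝ → ℝ) (x : Fin N → ℝ) : Prop :=
  (∀ n, 0 ≤ x n) ∧
  ∀ n, ∀ z : ℝ, 0 ≤ z →
    z * p (z + ∑ m ∈ Finset.univ.erase n, x m) - C n z ≤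
      x n * p (x n + ∑ m ∈ Finset.univ.erase n, x m) - C n (x n)

/-- A monopoly output: a nonnegative vector maximizing total profit. -/
def MonopolyOutput {N : ℕ} (C : Fin N → ℝ → ℝ) (p : ℝ → ℝ) (x : Fin N → ℝ) : Prop :=
  (∀ n, 0 ≤ x n) ∧
  ∀ y : Fin N → ℝ, (∀ n, 0 ≤ y n) →
    p (∑ n, y n) * (∑ n, y n) - ∑ n, C n (y n) ≤
      p (∑ n, x n) * (∑ n, x n) - ∑ n, C n (x n)

/-- The quantity `φ` appearing in the efficiency bound `f`. -/
def phi (c : ℝ) : ℝ := max ((2 - c + Real.sqrt (c ^ 2 - 4 * c + 12)) / 2) 1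

/-- The efficiency lower bound `f(c̄) = (φ² + 2)/(φ² + 2φ + c̄)`. -/
def fbound (c : ℝ) : ℝ := (phi c ^ 2 + 2) / (phi c ^ 2 + 2 * phi c + c)

theorem aux_lt {N : ℕ}
    (C C' : Fin N → ℝ → ℝ) (p pl pr : ℝ → ℝ)
    (hC : ∀ n, CostAssumption (C n) (C' n))
    (hp : DemandAssumption p pl pr)
    (x y : Fin N → ℝ)
    (hx : SocialOptimum C p x) (hy : SocialOptimum C p y)
    (hlt : ∑ n, x n < ∑ n, y n) :
    p (∑ n, x n) = p (∑ n, y n) := by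
  obtain ⟨hcont, -, hanti, -⟩ := hp
  have hX0 : 0 ≤ ∑ n, x n := Finset.sum_nonneg fun n _ => hx.1 n
  have hm0 : ∀ n, 0 ≤ (1/2 : ℝ) * x n + (1/2 : ℝ) * y n := fun n => by
    have := hx.1 n
    have := hy.1 n
    linarith
  have h1 := hx.2 _ hm0
  have h2 := hy.2 _ hm0
  have hcv : ∑ n, C n ((1/2 : ℝ) * x n + (1/2 : ℝ) * y n)
      ≤ (1/2 : ℝ) * ∑ n, C n (x n) + (1/2 : ℝ) * ∑ n, C n (y n) := by
    rw [Finset.mul_sum, Finset.mul_sum, ← Finset.sum_add_distrib]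
    refine Finset.sum_le_sum fun n _ => ?_
    have hc := (hC n).1.2 (show x n ∈ Set.Ici (0:ℝ) from hx.1 n)
      (show y n ∈ Set.Ici (0:ℝ) from hy.1 n)
      (show (0:ℝ) ≤ 1/2 by norm_num) (show (0:ℝ) ≤ 1/2 by norm_num) (by norm_num)
    simpa only [smul_eq_mul] using hc
  unfold SW at h1 h2
  rw [Finset.sum_add_distrib, ← Finset.mul_sum, ← Finset.mul_sum] at h1 h2
  generalize ∑ n, x n = X at *
  generalize ∑ n, y n = Y at *
  obtain ⟨h, rfl⟩ : ∃ h, Y = X + 2 * h := ⟨(Y - X) / 2, by ring⟩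
  have hh : 0 < h := by linarith
  have hM : (1/2 : ℝ) * X + (1/2 : ℝ) * (X + 2 * h) = X + h := by ring
  rw [hM] at h1 h2
  have hint : ∀ a b, 0 ≤ a → 0 ≤ b → IntervalIntegrable p MeasureTheory.volume a b := by
    intro a b ha hb
    apply ContinuousOn.intervalIntegrable
    refine hcont.mono fun q hq => ?_
    exact le_trans (le_min ha hb) hq.1
  have e1 := intervalIntegral.integral_add_adjacent_intervals
    (hint 0 X le_rfl hX0) (hint X (X + h) hX0 (by linarith))
  have e2 := intervalIntegral.integral_add_adjacent_intervals
    (hint 0 (X + h) le_rfl (by linarith)) (hint (X + h) (X + 2 * h) (by linarith) (by linarith))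
  have e3 : ∫ q in X..(X + h), p (q + h) = ∫ q in (X + h)..(X + 2 * h), p q := by
    rw [intervalIntegral.integral_comp_add_right]
    congr 1
    ring
  have key : ¬ (∫ q in X..(X + h), p (q + h)) < ∫ q in X..(X + h), p q := by
    rw [e3]
    intro hk
    linarith
  have hstrict : ∀ c ∈ Set.Icc X (X + h), p c ≤ p (c + h) := by
    intro c hc
    by_contra hcon
    push Not at hcon
    apply key
    refine intervalIntegral.integral_lt_integral_of_continuousOn_of_le_of_exists_lt
      (by linarith) ?_ ?_ ?_ ⟨c, hc, hcon⟩
    · refine hcont.comp (by fun_prop) fun q hq => ?_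
      have := hq.1
      show 0 ≤ q + h
      linarith
    · exact hcont.mono fun q hq => le_trans hX0 hq.1
    · intro q hq
      have h0 : 0 ≤ q := le_trans hX0 hq.1.le
      exact hanti h0 (show 0 ≤ q + h by linarith) (by linarith)
  have a1 := hstrict X ⟨le_rfl, by linarith⟩
  have a2 := hstrict (X + h) ⟨by linarith, le_rfl⟩
  rw [show X + h + h = X + 2 * h by ring] at a2
  exact le_antisymm (a1.trans a2) (hanti hX0 (show 0 ≤ X + 2 * h by linarith) hlt.le)

/-- All social optima result in the same price. -/
theorem social_optima_same_price {N : ℕ} (hN : 0 < N)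
    (C C' : Fin N → ℝ → ℝ) (p pl pr : ℝ → ℝ)
    (hC : ∀ n, CostAssumption (C n) (C' n))
    (hp : DemandAssumption p pl pr)
    (xS xSbar : Fin N → ℝ)
    (hxS : SocialOptimum C p xS) (hxSbar : SocialOptimum C p xSbar) :
    p (∑ n, xS n) = p (∑ n, xSbar n) := by
  rcases lt_trichotomy (∑ n, xS n) (∑ n, xSbar n) with h | h | h
  · exact aux_lt C C' p pl pr hC hp xS xSbar hxS hxSbar h
  · rw [h]
  · exact (aux_lt C C' p pl pr hC hp xSbar xS hxSbar hxS h).symm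

end
end

section
/- Suppose Assumptions 1 and 2 hold and the inverse demand function p is convex. If x is a Cournot candidate with aggregate supply X = Σ_{n=1}^N x_n > 0, then p is differentiable at X, i.e., the left derivative of p at X equals the right derivative of p at X. -/
open Finset Set

noncomputable section

/-- At a Cournot candidate with positive aggregate supply, a convex inverse demand
function is differentiable: its left and right derivatives coincide. -/
theorem cournot_candidate_demand_differentiable {N : ℕ} (hN : 0 < N)
    (C C' : Fin N → ℝ → ℝ) (p pl pr : ℝ → ℝ)
    (hC : ∀ n, CostAssumption (C n) (C' n))
    (hp : DemandAssumption p pl pr)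
    (hconv : ConvexOn ℝ (Set.Ici 0) p)
    (x : Fin N → ℝ) (hx : CournotCandidate C' p pl pr x)
    (hX : 0 < ∑ n, x n) :
    pl (∑ n, x n) = pr (∑ n, x n) := by
  obtain ⟨-, -, -, -, -, hr, hl⟩ := hp
  obtain ⟨hx0, hx1⟩ := hx
  apply le_antisymm
  · have h := hconv.leftDeriv_le_rightDeriv_of_mem_interior
      (x := ∑ n, x n) (by rw [interior_Ici]; exact hX)
    have h1 := ((hl _ hX).mono Set.Iio_subset_Iic_self).derivWithin (uniqueDiffWithinAt_Iio _)
    have h2 := ((hr _ hX).mono Set.Ioi_subset_Ici_self).derivWithin (uniqueDiffWithinAt_Ioi _)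
    rwa [h1, h2] at h
  · obtain ⟨n, -, hn⟩ := Finset.exists_lt_of_sum_lt (s := Finset.univ)
      (f := fun _ : Fin N => (0:ℝ)) (g := x) (by simpa using hX)
    have h := ((hx1 n).2.trans ((hx1 n).1 hn))
    exact le_of_mul_le_mul_left (by linarith) hn

end
end

section
/- Suppose Assumptions 1–4 hold. Then the social welfare achieved at any Cournot candidate is positive, and the optimal social welfare is positive. -/
open Finset Set

noncomputable section

lemma aux_small {C : ℝ → ℝ} {c P : ℝ} (h : HasDerivWithinAt C c (Set.Ici 0) 0) (h0 : C 0 = 0)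
    (hc : c < P) : ∀ᶠ y in nhdsWithin (0:ℝ) (Set.Ioi 0), C y < P * y := by
  have h1 := hasDerivWithinAt_iff_tendsto_slope.1 h
  have h2 : Set.Ici (0:ℝ) \ {0} = Set.Ioi 0 := by
    ext y
    simp only [Set.mem_diff, Set.mem_Ici, Set.mem_singleton_iff, Set.mem_Ioi]
    exact ⟨fun h => lt_of_le_of_ne h.1 (Ne.symm h.2), fun h => ⟨h.le, h.ne'⟩⟩
  rw [h2] at h1
  filter_upwards [h1.eventually (gt_mem_nhds hc), self_mem_nhdsWithin] with y hy hy0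
  have hy0' : (0:ℝ) < y := hy0
  rw [slope_def_field, h0, sub_zero, sub_zero, div_lt_iff₀ hy0'] at hy
  exact hy

lemma aux_tangent {C C' : ℝ → ℝ} (h : CostAssumption C C') {x y P : ℝ} (hy : 0 ≤ y) (hyx : y < x)
    (hP : C' x ≤ P) : C x ≤ C y + P * (x - y) := by
  obtain ⟨hconv, -, -, hd, -⟩ := h
  have hx : 0 < x := lt_of_le_of_lt hy hyx
  have := hconv.slope_le_of_hasDerivAt (Set.mem_Ici.2 hy) (Set.mem_Ici.2 hx.le) hyx (hd x hx)
  rw [slope_def_field, div_le_iff₀ (sub_pos.2 hyx)] at this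
  have h2 := mul_le_mul_of_nonneg_right hP (sub_pos.2 hyx).le
  linarith

lemma aux_int {p : ℝ → ℝ} (hc : ContinuousOn p (Set.Ici 0)) (ha : AntitoneOn p (Set.Ici 0))
    {X : ℝ} (hX : 0 < X) : X * p X ≤ ∫ q in (0:ℝ)..X, p q := by
  have hci : ContinuousOn p (Set.Icc 0 X) := hc.mono Set.Icc_subset_Ici_self
  have := intervalIntegral.integral_mono_on (μ := MeasureTheory.volume) hX.le
    (f := fun _ => p X) (g := p) (by simp)
    (hci.intervalIntegrable_of_Icc hX.le)
    (fun q hq => ha hq.1 hX.le hq.2)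
  simpa using this

lemma aux_int_lt {p : ℝ → ℝ} (hc : ContinuousOn p (Set.Ici 0)) (ha : AntitoneOn p (Set.Ici 0))
    {X : ℝ} (hX : 0 < X) (hlt : p X < p 0) : X * p X < ∫ q in (0:ℝ)..X, p q := by
  have hci : ContinuousOn p (Set.Icc 0 X) := hc.mono Set.Icc_subset_Ici_self
  have := intervalIntegral.integral_lt_integral_of_continuousOn_of_le_of_exists_lt hX
    (f := fun _ => p X) (g := p) continuousOn_const hci
    (fun q hq => ha hq.1.le hX.le hq.2) ⟨0, ⟨le_rfl, hX.le⟩, hlt⟩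
  simpa using this

lemma aux_pl {p : ℝ → ℝ} {d X : ℝ} (ha : AntitoneOn p (Set.Ici 0)) (hX : 0 < X)
    (hd : HasDerivWithinAt p d (Set.Iic X) X) : d ≤ 0 := by
  have h1 := hasDerivWithinAt_iff_tendsto_slope.1 hd
  have h2 : Set.Iic X \ {X} = Set.Iio X := by
    ext y
    simp only [Set.mem_diff, Set.mem_Iic, Set.mem_singleton_iff, Set.mem_Iio]
    exact ⟨fun h => lt_of_le_of_ne h.1 h.2, fun h => ⟨h.le, h.ne⟩⟩
  rw [h2] at h1
  refine le_of_tendsto h1 ?_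
  filter_upwards [self_mem_nhdsWithin, mem_nhdsWithin_of_mem_nhds (lt_mem_nhds hX)] with y hy hy0
  have hy' : y < X := hy
  have hy0' : 0 < y := hy0
  rw [slope_def_field]
  exact div_nonpos_of_nonneg_of_nonpos
    (sub_nonneg.2 (ha hy0'.le hX.le hy'.le)) (sub_nonpos.2 hy'.le)

/-- Under Assumptions 1-4, the social welfare at any Cournot candidate is positive,
and the optimal social welfare is positive. -/
theorem cournot_candidate_welfare_positive {N : ℕ} (hN : 0 < N)
    (C C' : Fin N → ℝ → ℝ) (p pl pr : ℝ → ℝ)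
    (hC : ∀ n, CostAssumption (C n) (C' n))
    (hp : DemandAssumption p pl pr)
    (hA3 : ∃ R : ℝ, 0 < R ∧ ∀ n, p R ≤ C' n 0)
    (hA4 : ∃ n, C' n 0 < p 0) :
    (∀ x : Fin N → ℝ, CournotCandidate C' p pl pr x → 0 < SW C p x) ∧
    (∃ y : Fin N → ℝ, (∀ n, 0 ≤ y n) ∧ 0 < SW C p y) := by
  obtain ⟨n0, hn0⟩ := hA4
  obtain ⟨hpc, hpn, hpa, hp0, hpr0, hpr, hpl⟩ := hp
  refine ⟨?_, ?_⟩
  · rintro x ⟨hx, hcc⟩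
    have hX0 : 0 ≤ ∑ m, x m := Finset.sum_nonneg (fun i _ => hx i)
    unfold SW
    set X := ∑ m, x m with hXdef
    have hX : 0 < X := by
      rcases hX0.lt_or_eq with h | h
      · exact h
      · exfalso
        have hz : x n0 = 0 :=
          (Finset.sum_eq_zero_iff_of_nonneg (fun i _ => hx i)).1 h.symm n0 (Finset.mem_univ _)
        have := (hcc n0).2
        rw [hz, ← h] at this
        linarith
    have hplX : pl X ≤ 0 := aux_pl hpa hX (hpl X hX)
    have hC' : ∀ n, 0 < x n → C' n (x n) ≤ p X := fun n hn => by
      have := (hcc n).1 hn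
      have := mul_nonpos_of_nonneg_of_nonpos hn.le hplX
      linarith
    have hle : ∀ n, C n (x n) ≤ x n * p X := fun n => by
      have h0 : C n 0 = 0 := (hC n).2.2.2.2.2.2
      rcases (hx n).lt_or_eq with h | h
      · have := aux_tangent (hC n) le_rfl h (hC' n h)
        rw [h0] at this
        linarith
      · rw [← h, h0]; simp
    have hXs : X * p X = ∑ n, x n * p X := by rw [hXdef, Finset.sum_mul]
    rcases (hpa (Set.mem_Ici.2 le_rfl) hX.le hX.le).lt_or_eq with h | h
    · have h1 := aux_int_lt hpc hpa hX h
      have h2 : ∑ n, C n (x n) ≤ ∑ n, x n * p X := Finset.sum_le_sum (fun n _ => hle n)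
      linarith
    · have h1 := aux_int hpc hpa hX
      have hxn : 0 < x n0 := by
        rcases (hx n0).lt_or_eq with h' | h'
        · exact h'
        · exfalso
          have := (hcc n0).2
          rw [← h'] at this
          linarith
      have hlt : C n0 (x n0) < x n0 * p X := by
        rw [← h] at hn0
        have he := aux_small (hC n0).2.2.2.2.2.1 (hC n0).2.2.2.2.2.2 hn0
        obtain ⟨y, hy1, hy2⟩ := (he.and (Ioo_mem_nhdsGT hxn)).exists
        have := aux_tangent (hC n0) hy2.1.le hy2.2 (hC' n0 hxn)
        linarith
      have h2 : ∑ n, C n (x n) < ∑ n, x n * p X :=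
        Finset.sum_lt_sum (fun n _ => hle n) ⟨n0, Finset.mem_univ _, hlt⟩
      linarith
  · obtain ⟨c, hc1, hc2⟩ := exists_between hn0
    have he := aux_small (hC n0).2.2.2.2.2.1 (hC n0).2.2.2.2.2.2 hc1
    have hp' : ∀ᶠ y in nhdsWithin (0:ℝ) (Set.Ioi 0), c < p y :=
      ((hpc 0 (Set.mem_Ici.2 le_rfl)).mono Set.Ioi_subset_Ici_self).eventually (lt_mem_nhds hc2)
    obtain ⟨y, ⟨hy1, hy2⟩, hy3⟩ := ((he.and hp').and self_mem_nhdsWithin).exists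
    have hy : 0 < y := hy3
    refine ⟨Pi.single n0 y, fun n => ?_, ?_⟩
    · by_cases h : n = n0
      · subst h; simpa using hy.le
      · simp [h]
    · have hs : ∑ n, (Pi.single n0 y : Fin N → ℝ) n = y := by simp
      have hs2 : ∑ n, C n ((Pi.single n0 y : Fin N → ℝ) n) = C n0 y := by
        rw [Finset.sum_eq_single n0]
        · simp
        · intro b _ hb
          simp [hb, (hC b).2.2.2.2.2.2]
        · simp
      unfold SW
      rw [hs, hs2]
      have h1 := aux_int hpc hpa hy
      have h2 := mul_lt_mul_of_pos_left hy2 hy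
      linarith

end
end

section
/- Suppose Assumptions 1–4 hold and the inverse demand function p is convex. Let x be a Cournot candidate which is not a social optimum, and let α_n = C_n'(x_n) for each n. Consider the modified model in which the cost function of each supplier n is replaced by the linear function C̄_n(z) = α_n·z for z ≥ 0. Then for the modified model Assumptions 1–4 still hold, x is a Cournot candidate of the modified model, and the efficiency γ̄(x) of x in the modified model satisfies 0 < γ̄(x) ≤ γ(x), where γ(x) is the efficiency of x in the original model. -/
open Finset Set

noncomputable section

lemma cost_tangent {C C' : ℝ → ℝ} (h : CostAssumption C C') {a b : ℝ} (ha : 0 ≤ a) (hb : 0 ≤ b) :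
    C a + C' a * (b - a) ≤ C b := by
  obtain ⟨hc, -, -, hd, -, h0, -⟩ := h
  have hw : HasDerivWithinAt C (C' a) (Set.Ici 0) a := by
    rcases ha.eq_or_lt with rfl | h
    · exact h0
    · exact (hd a h).hasDerivWithinAt
  rcases lt_trichotomy a b with h | rfl | h
  · have := hc.le_slope_of_hasDerivWithinAt ha hb h hw
    rw [slope_def_field, le_div_iff₀ (by linarith)] at this
    linarith
  · simp
  · have := hc.slope_le_of_hasDerivWithinAt hb ha h hw
    rw [slope_def_field, div_le_iff₀ (by linarith)] at this
    linarith

lemma cost_deriv_mono {C C' : ℝ → ℝ} (h : CostAssumption C C') {a : ℝ} (ha : 0 ≤ a) :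
    C' 0 ≤ C' a := by
  rcases ha.eq_or_lt with rfl | h'
  · exact le_rfl
  · have h1 := cost_tangent h ha le_rfl
    have h2 := cost_tangent h le_rfl ha
    by_contra hlt
    push Not at hlt
    nlinarith

lemma accPt_aux {s : Set ℝ} (hs : UniqueDiffOn ℝ s) {a : ℝ} (ha : a ∈ s) :
    AccPt a (Filter.principal s) :=
  (hs a ha).accPt

lemma cost_deriv_nonneg {C C' : ℝ → ℝ} (h : CostAssumption C C') : 0 ≤ C' 0 :=
  h.2.2.2.2.2.1.nonneg_of_monotoneOn (accPt_aux (uniqueDiffOn_Ici 0) (by simp)) h.2.2.1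

/-- Replacing the cost functions by the linear functions with slopes `αₙ = Cₙ'(xₙ)`
preserves Assumptions 1-4 and the Cournot-candidate property, and the efficiency of
`x` in the modified model is positive and no larger than in the original model. -/
theorem linear_cost_worst_case {N : ℕ} (hN : 0 < N)
    (C C' : Fin N → ℝ → ℝ) (p pl pr : ℝ → ℝ)
    (hC : ∀ n, CostAssumption (C n) (C' n))
    (hp : DemandAssumption p pl pr)
    (hA3 : ∃ R : ℝ, 0 < R ∧ ∀ n, p R ≤ C' n 0)
    (hA4 : ∃ n, C' n 0 < p 0)
    (hconv : ConvexOn ℝ (Set.Ici 0) p)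
    (x : Fin N → ℝ) (hx : CournotCandidate C' p pl pr x)
    (hnopt : ¬ SocialOptimum C p x)
    (α : Fin N → ℝ) (hα : ∀ n, α n = C' n (x n)) :
    (∀ n, CostAssumption (fun z => α n * z) (fun _ => α n)) ∧
    (∃ R : ℝ, 0 < R ∧ ∀ n, p R ≤ α n) ∧
    (∃ n, α n < p 0) ∧
    CournotCandidate (fun n _ => α n) p pl pr x ∧
    (∀ xS yS : Fin N → ℝ, SocialOptimum C p xS →
      SocialOptimum (fun n z => α n * z) p yS →
      0 < SW (fun n z => α n * z) p x / SW (fun n z => α n * z) p yS ∧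
      SW (fun n z => α n * z) p x / SW (fun n z => α n * z) p yS ≤
        SW C p x / SW C p xS) := by
  obtain ⟨hpc, hp0, hpa, hpp, -, -, hpl⟩ := hp
  obtain ⟨hx0, hx1⟩ := hx
  obtain ⟨R, hR, hRp⟩ := hA3
  obtain ⟨k, hk⟩ := hA4
  have hα0 : ∀ n, C' n 0 ≤ α n := fun n => by
    rw [hα]; exact cost_deriv_mono (hC n) (hx0 n)
  have hαn : ∀ n, 0 ≤ α n := fun n => (cost_deriv_nonneg (hC n)).trans (hα0 n)
  have hX0 : 0 ≤ ∑ m, x m := Finset.sum_nonneg fun n _ => hx0 n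
  have hX : 0 < ∑ m, x m := by
    rcases hX0.eq_or_lt with h | h
    · exfalso
      have hz : x k = 0 :=
        (Finset.sum_eq_zero_iff_of_nonneg fun n _ => hx0 n).1 h.symm k (Finset.mem_univ k)
      have := (hx1 k).2
      rw [← h, hz] at this
      linarith
    · exact h
  set X := ∑ m, x m with hXdef
  have hpR : p R < p 0 := (hRp k).trans_lt hk
  have hpX : p X < p 0 := by
    rcases le_or_gt R X with h | h
    · exact (hpa hR.le hX0 h).trans_lt hpR
    · have := hconv.2 (Set.mem_Ici.2 le_rfl) (Set.mem_Ici.2 hR.le)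
        (sub_nonneg.2 ((div_le_one hR).2 h.le)) (div_nonneg hX0 hR.le) (by ring)
      simp only [smul_eq_mul, mul_zero, zero_add] at this
      rw [div_mul_cancel₀ _ hR.ne'] at this
      have h2 : 0 < X / R := div_pos hX hR
      nlinarith
  have hplX : pl X ≤ 0 :=
    ((hpl X hX).mono Set.Icc_subset_Iic_self).nonpos_of_antitoneOn
      (accPt_aux (uniqueDiffOn_Icc hX) (Set.right_mem_Icc.2 hX0))
      (hpa.mono Set.Icc_subset_Ici_self)
  have hαp : ∀ n, 0 < x n → α n ≤ p X := fun n hn => by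
    have := (hx1 n).1 hn
    rw [hα]
    nlinarith [mul_nonneg hn.le (neg_nonneg.2 hplX)]
  refine ⟨fun n => ⟨?_, by fun_prop, ?_, ?_, by fun_prop, ?_, by simp⟩,
    ⟨R, hR, fun n => (hRp n).trans (hα0 n)⟩, ?_, ⟨hx0, fun n => ?_⟩, ?_⟩
  · exact (LinearMap.mulLeft ℝ (α n)).convexOn (convex_Ici 0)
  · intro a _ b _ hab
    exact mul_le_mul_of_nonneg_left hab (hαn n)
  · intro z _
    simpa using (hasDerivAt_id z).const_mul (α n)
  · simpa using ((hasDerivAt_id (0:ℝ)).const_mul (α n)).hasDerivWithinAt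
  · obtain ⟨n, -, hn⟩ := Finset.exists_lt_of_sum_lt (s := Finset.univ) (f := fun _ => (0:ℝ)) (g := x)
      (by simpa using hX)
    exact ⟨n, (hαp n hn).trans_lt hpX⟩
  · beta_reduce; rw [hα]
    exact hx1 n
  · intro xS yS hxS hyS
    set A := SW (fun n z => α n * z) p x with hA
    set B := SW (fun n z => α n * z) p yS with hB
    set δ := ∑ n, (α n * x n - C n (x n)) with hδ
    have hδ0 : 0 ≤ δ := Finset.sum_nonneg fun n _ => by
      have := cost_tangent (hC n) (hx0 n) le_rfl
      rw [(hC n).2.2.2.2.2.2, ← hα] at this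
      linarith
    have hint : p X * X < ∫ q in (0:ℝ)..X, p q := by
      have := intervalIntegral.integral_lt_integral_of_continuousOn_of_le_of_exists_lt
        (f := fun _ => p X) (g := p) hX continuousOn_const (hpc.mono Set.Icc_subset_Ici_self)
        (fun q hq => hpa hq.1.le hX0 hq.2) ⟨0, Set.left_mem_Icc.2 hX0, hpX⟩
      simp at this
      linarith
    have hApos : 0 < A := by
      have : ∑ n, α n * x n ≤ p X * X := by
        rw [hXdef, Finset.mul_sum]
        refine Finset.sum_le_sum fun n _ => ?_
        rcases (hx0 n).eq_or_lt with h | h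
        · rw [← h]; simp
        · exact mul_le_mul_of_nonneg_right (hαp n h) h.le
      have h2 : A = (∫ q in (0:ℝ)..X, p q) - ∑ n, α n * x n := rfl
      linarith
    have hAB : A ≤ B := hyS.2 x hx0
    have hBpos : 0 < B := hApos.trans_le hAB
    have hSx : SW C p x = A + δ := by
      rw [hA, hδ, Finset.sum_sub_distrib]
      simp only [SW]
      ring
    have hSle : SW C p xS ≤ B + δ := by
      have h1 : SW (fun n z => α n * z) p xS ≤ B := hyS.2 xS hxS.1
      have h2 : SW C p xS ≤ SW (fun n z => α n * z) p xS + δ := by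
        have h3 : ∑ n, (α n * xS n - C n (xS n)) ≤ δ := Finset.sum_le_sum fun n _ => by
          have := cost_tangent (hC n) (hx0 n) (hxS.1 n)
          rw [← hα] at this
          linarith
        rw [Finset.sum_sub_distrib] at h3
        simp only [SW]
        linarith
      linarith
    have hSge : A + δ ≤ SW C p xS := hSx ▸ hxS.2 x hx0
    have hSpos : 0 < SW C p xS := by linarith
    refine ⟨div_pos hApos hBpos, ?_⟩
    rw [hSx, div_le_div_iff₀ hBpos hSpos]
    nlinarith [mul_le_mul_of_nonneg_left hSle hApos.le, mul_le_mul_of_nonneg_left hAB hδ0]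

end
end

section
/- Suppose Assumptions 1–4 hold. Let x be a Cournot candidate and let x^S be a social optimum, with aggregate supplies X and X^S respectively. If p(X) ≠ p(X^S), then p(X) > p(X^S) and X < X^S. -/
open Finset Set

noncomputable section

theorem aux_pl_nonpos (p : ℝ → ℝ) (X d : ℝ) (hX : 0 < X) (ha : AntitoneOn p (Set.Ici 0))
    (hd : HasDerivWithinAt p d (Set.Iic X) X) : d ≤ 0 := by
  rw [hasDerivWithinAt_iff_tendsto_slope] at hd
  have e : Set.Iic X \ {X} = Set.Iio X := by
    ext y; simp [lt_iff_le_and_ne]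
  rw [e] at hd
  refine le_of_tendsto hd ?_
  have h1 : ∀ᶠ y in nhdsWithin X (Set.Iio X), (0:ℝ) < y :=
    nhdsWithin_le_nhds (lt_mem_nhds hX)
  filter_upwards [h1, self_mem_nhdsWithin] with y hy hyX
  have hyX' : y < X := hyX
  have := ha (Set.mem_Ici.2 hy.le) (Set.mem_Ici.2 hX.le) hyX'.le
  rw [slope_def_field]
  exact div_nonpos_of_nonneg_of_nonpos (by linarith) (by linarith)

/-- If the price at a Cournot candidate differs from the socially optimal price,
then the candidate price is higher and the candidate aggregate supply is lower. -/
theorem cournot_candidate_price_supply_comparison {N : ℕ} (hN : 0 < N)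
    (C C' : Fin N → ℝ → ℝ) (p pl pr : ℝ → ℝ)
    (hC : ∀ n, CostAssumption (C n) (C' n))
    (hp : DemandAssumption p pl pr)
    (hA3 : ∃ R : ℝ, 0 < R ∧ ∀ n, p R ≤ C' n 0)
    (hA4 : ∃ n, C' n 0 < p 0)
    (x xS : Fin N → ℝ)
    (hx : CournotCandidate C' p pl pr x)
    (hxS : SocialOptimum C p xS)
    (hne : p (∑ n, x n) ≠ p (∑ n, xS n)) :
    p (∑ n, xS n) < p (∑ n, x n) ∧ (∑ n, x n) < ∑ n, xS n := by
  obtain ⟨hpc, hp0, hpa, hpp, hpr0, hpr, hpl⟩ := hp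
  obtain ⟨hx0, hxc⟩ := hx
  obtain ⟨hs0, hopt⟩ := hxS
  have hX0 : 0 ≤ ∑ n, x n := Finset.sum_nonneg fun n _ => hx0 n
  have hS0 : 0 ≤ ∑ n, xS n := Finset.sum_nonneg fun n _ => hs0 n
  have key : p (∑ n, xS n) < p (∑ n, x n) := by
    by_contra hcon
    have hlt : p (∑ n, x n) < p (∑ n, xS n) := lt_of_le_of_ne (not_lt.1 hcon) hne
    have hXS : ∑ n, xS n < ∑ n, x n := by
      by_contra h
      exact absurd (hpa hX0 hS0 (not_lt.1 h)) (not_le.2 hlt)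
    obtain ⟨n, -, hn⟩ := Finset.exists_lt_of_sum_lt hXS
    have hxn : 0 < x n := lt_of_le_of_lt (hs0 n) hn
    have hXpos : 0 < ∑ n, x n := lt_of_le_of_lt hS0 hXS
    have hpln := aux_pl_nonpos p _ _ hXpos hpa (hpl _ hXpos)
    have hC1 : C' n (x n) ≤ p (∑ n, x n) := by
      have := (hxc n).1 hxn
      have := mul_nonpos_of_nonneg_of_nonpos hxn.le hpln
      linarith
    obtain ⟨hcv, -, -, hder, -, -, -⟩ := hC n
    have hcont := hpc _ (Set.mem_Ici.2 hS0)
    have hev := hcont.eventually (lt_mem_nhds hlt)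
    obtain ⟨δ, hδ, hball⟩ := Metric.mem_nhdsWithin_iff.1 hev
    set S := ∑ n, xS n with hS
    set t := min (δ / 2) (x n - xS n) with ht
    have htpos : 0 < t := lt_min (by linarith) (by linarith)
    have ht1 : t ≤ δ / 2 := min_le_left _ _
    have ht2 : t ≤ x n - xS n := min_le_right _ _
    have hpt : p (∑ n, x n) < p (S + t) := by
      apply hball
      refine ⟨?_, Set.mem_Ici.2 (by linarith)⟩
      rw [Metric.mem_ball, Real.dist_eq, add_sub_cancel_left, abs_of_pos htpos]
      linarith
    have hcost : C n (xS n + t) - C n (xS n) ≤ t * C' n (x n) := by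
      have h1 := hcv.secant_mono (a := xS n) (x := xS n + t) (y := x n) (hs0 n)
        (Set.mem_Ici.2 (by linarith [hs0 n])) (hx0 n) (by linarith) hn.ne' (by linarith)
      have h2 := hcv.slope_le_of_hasDerivAt (hs0 n) (hx0 n) hn (hder _ hxn)
      rw [slope_def_field] at h2
      have h3 := h1.trans h2
      rw [add_sub_cancel_left, div_le_iff₀ htpos] at h3
      linarith
    have hii : ∀ a b : ℝ, 0 ≤ a → 0 ≤ b → IntervalIntegrable p MeasureTheory.volume a b := by
      intro a b h1 h2
      apply ContinuousOn.intervalIntegrable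
      apply hpc.mono
      intro z hz
      exact (le_min h1 h2).trans hz.1
    have hint : t * p (S + t) ≤ ∫ q in S..(S + t), p q := by
      have h := intervalIntegral.integral_mono_on (f := fun _ => p (S + t)) (g := p)
        (μ := MeasureTheory.volume) (a := S) (b := S + t) (by linarith) (by simp)
        (hii _ _ hS0 (by linarith))
        (fun z hz => hpa (Set.mem_Ici.2 (hS0.trans hz.1)) (Set.mem_Ici.2 (by linarith)) hz.2)
      simpa using h
    have hsub := intervalIntegral.integral_interval_sub_left (hii 0 (S + t) le_rfl (by linarith))
      (hii 0 S le_rfl hS0)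
    have hy := hopt (fun m => xS m + if m = n then t else 0) (fun m => by
      have := hs0 m
      split_ifs <;> linarith)
    have hcs : ∑ m, C m (xS m + if m = n then t else 0)
        = ∑ m, C m (xS m) + (C n (xS n + t) - C n (xS n)) := by
      rw [← sub_eq_iff_eq_add', ← Finset.sum_sub_distrib, Finset.sum_eq_single n]
      · simp
      · intro b _ hb; simp [hb]
      · simp
    have hss : ∑ m, (xS m + if m = n then t else 0) = S + t := by
      rw [Finset.sum_add_distrib]; simp [hS]
    unfold SW at hy
    rw [hcs, hss, ← hS] at hy
    have h5 : t * C' n (x n) < t * p (S + t) := mul_lt_mul_of_pos_left (by linarith) htpos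
    linarith
  refine ⟨key, ?_⟩
  by_contra h
  exact absurd (hpa hS0 hX0 (not_lt.1 h)) (not_le.2 key)

end
end

section
/- Suppose Assumptions 1–4 hold and the inverse demand function p is convex. Let x be a Cournot candidate and let x^S be a social optimum, with aggregate supplies X and X^S respectively. If p(X) = p(X^S), then p'(X) = 0 and the efficiency of x equals 1, i.e., x is socially optimal. -/
open Finset Set

noncomputable section

lemma aux_int_s6 {p : ℝ → ℝ} (hp : AntitoneOn p (Set.Ici 0)) {a b : ℝ} (ha : 0 ≤ a) (hb : 0 ≤ b) :
    (∫ q in (0:ℝ)..b, p q) - (∫ q in (0:ℝ)..a, p q) ≤ p a * (b - a) := by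
  have hI : ∀ u v : ℝ, 0 ≤ u → 0 ≤ v → IntervalIntegrable p MeasureTheory.volume u v := by
    intro u v hu hv
    refine (hp.mono ?_).intervalIntegrable
    intro t ht
    exact (le_min hu hv).trans ht.1
  rw [intervalIntegral.integral_interval_sub_left (hI _ _ le_rfl hb) (hI _ _ le_rfl ha)]
  rcases le_total a b with h | h
  · have := intervalIntegral.integral_mono_on (g := fun _ => p a) h (hI _ _ ha hb) (by simp)
      (fun t ht => hp ha (ha.trans ht.1 : (0:ℝ) ≤ t) ht.1)
    simp at this
    linarith
  · have := intervalIntegral.integral_mono_on (f := fun _ => p a) h (by simp) (hI _ _ hb ha)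
      (fun t ht => hp (hb.trans ht.1 : (0:ℝ) ≤ t) ha ht.2)
    rw [intervalIntegral.integral_symm]
    simp at this
    linarith

lemma aux_right {C C' : ℝ → ℝ} (hC : CostAssumption C C') {a : ℝ} (ha : 0 ≤ a) :
    HasDerivWithinAt C (C' a) (Set.Ioi a) a := by
  obtain ⟨_, _, _, h4, _, h6, _⟩ := hC
  rcases ha.eq_or_lt with h | h
  · subst h
    exact h6.mono Ioi_subset_Ici_self
  · exact (h4 a h).hasDerivWithinAt

lemma aux_grad {C C' : ℝ → ℝ} (hC : CostAssumption C C') {a y : ℝ} (ha : 0 ≤ a) (hy : 0 ≤ y) :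
    C' a * (y - a) ≤ C y - C a := by
  rcases lt_trichotomy a y with h | h | h
  · have := hC.1.le_slope_of_hasDerivWithinAt_Ioi ha hy h (aux_right hC ha)
    rw [slope_def_field, le_div_iff₀ (by linarith)] at this
    exact this
  · subst h; simp
  · have := hC.1.slope_le_of_hasDerivAt hy ha h (hC.2.2.2.1 a (hy.trans_lt h))
    rw [slope_def_field, div_le_iff₀ (by linarith)] at this
    linarith

lemma aux_opt {N : ℕ} {C C' : Fin N → ℝ → ℝ} {p : ℝ → ℝ}
    (hC : ∀ n, CostAssumption (C n) (C' n)) (hpc : ContinuousOn p (Set.Ici 0))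
    (hp : AntitoneOn p (Set.Ici 0)) {x : Fin N → ℝ} (hx : SocialOptimum C p x) (n : Fin N) :
    p (∑ m, x m) ≤ C' n (x n) := by
  obtain ⟨hx0, hx⟩ := hx
  have hX : 0 ≤ ∑ m, x m := Finset.sum_nonneg fun m _ => hx0 m
  have hlim := (hasDerivWithinAt_iff_tendsto_slope' self_notMem_Ioi).mp (aux_right (hC n) (hx0 n))
  have hcont : Filter.Tendsto (fun z => p (∑ m, x m + (z - x n))) (nhdsWithin (x n) (Set.Ioi (x n)))
      (nhds (p (∑ m, x m))) := by
    refine (hpc _ hX).tendsto.comp (tendsto_nhdsWithin_iff.2 ⟨?_, ?_⟩)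
    · have : Continuous fun z : ℝ => ∑ m, x m + (z - x n) := by fun_prop
      have := this.tendsto (x n)
      simp only [sub_self, add_zero] at this
      exact this.mono_left nhdsWithin_le_nhds
    · filter_upwards [self_mem_nhdsWithin] with z hz
      have : x n < z := hz
      simp only [Set.mem_Ici]; linarith
  refine le_of_tendsto_of_tendsto hcont hlim ?_
  filter_upwards [self_mem_nhdsWithin] with z hz
  have hz : x n < z := hz
  have h := hx (Function.update x n z) (by
    intro m
    by_cases hm : m = n
    · subst hm; simp; linarith [hx0 m]
    · simp [hm, hx0 m])
  have e1 : ∑ m, Function.update x n z m = ∑ m, x m + (z - x n) := by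
    rw [Finset.sum_update_of_mem (Finset.mem_univ n), Finset.sum_eq_add_sum_sdiff_singleton_of_mem (Finset.mem_univ n) x]
    ring
  have e2 : ∑ m, C m (Function.update x n z m) = ∑ m, C m (x m) + (C n z - C n (x n)) := by
    rw [Finset.sum_eq_add_sum_sdiff_singleton_of_mem (Finset.mem_univ n) (fun m => C m (x m)),
      Finset.sum_eq_add_sum_sdiff_singleton_of_mem (Finset.mem_univ n) (fun m => C m (Function.update x n z m))]
    have : ∑ m ∈ Finset.univ \ {n}, C m (Function.update x n z m) =
        ∑ m ∈ Finset.univ \ {n}, C m (x m) := by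
      refine Finset.sum_congr rfl fun m hm => ?_
      have : m ≠ n := by simpa using hm
      simp [this]
    simp only [this, Function.update_self]
    ring
  unfold SW at h
  rw [e1, e2] at h
  have hb := aux_int_s6 hp (a := ∑ m, x m + (z - x n)) (b := ∑ m, x m) (by linarith) hX
  rw [slope_def_field, le_div_iff₀ (by linarith)]
  linarith

lemma aux_nonneg {p : ℝ → ℝ} {d X Y : ℝ} (hXY : X < Y) (h : HasDerivWithinAt p d (Set.Ici X) X)
    (hc : ∀ t, X < t → t < Y → p X ≤ p t) : 0 ≤ d := by
  have hlim := (hasDerivWithinAt_iff_tendsto_slope' self_notMem_Ioi).mp (h.mono Ioi_subset_Ici_self)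
  refine ge_of_tendsto hlim ?_
  filter_upwards [Ioo_mem_nhdsGT hXY] with t ht
  rw [slope_def_field]
  exact div_nonneg (by linarith [hc t ht.1 ht.2]) (by linarith [ht.1])

/-- If the price at a Cournot candidate equals the socially optimal price and `p` is
convex, then `p'(X) = 0` and the candidate is socially optimal with efficiency one. -/
theorem cournot_candidate_equal_price_optimal {N : ℕ} (hN : 0 < N)
    (C C' : Fin N → ℝ → ℝ) (p pl pr : ℝ → ℝ)
    (hC : ∀ n, CostAssumption (C n) (C' n))
    (hp : DemandAssumption p pl pr)
    (hA3 : ∃ R : ℝ, 0 < R ∧ ∀ n, p R ≤ C' n 0)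
    (hA4 : ∃ n, C' n 0 < p 0)
    (hconv : ConvexOn ℝ (Set.Ici 0) p)
    (x xS : Fin N → ℝ)
    (hx : CournotCandidate C' p pl pr x)
    (hxS : SocialOptimum C p xS)
    (heq : p (∑ n, x n) = p (∑ n, xS n)) :
    pl (∑ n, x n) = 0 ∧ pr (∑ n, x n) = 0 ∧
    SocialOptimum C p x ∧ SW C p x / SW C p xS = 1 := by
  obtain ⟨hpc, hp0, hpa, hpp, _, hpr, hpl⟩ := hp
  obtain ⟨hx0, hxc⟩ := hx
  have hX0 : 0 ≤ ∑ m, x m := Finset.sum_nonneg fun m _ => hx0 m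
  have hoS := aux_opt hC hpc hpa hxS
  -- positive aggregate supply
  have hXpos : 0 < ∑ m, x m := by
    rcases hX0.eq_or_lt with h | h
    · exfalso
      have hz := (Finset.sum_eq_zero_iff_of_nonneg (fun m _ => hx0 m)).1 h.symm
      obtain ⟨n, hn⟩ := hA4
      have := (hxc n).2
      rw [hz n (Finset.mem_univ n), ← h] at this
      linarith
    · exact h
  have hpl' := hpl _ hXpos
  have hpr' := hpr _ hXpos
  have hle : pl (∑ m, x m) ≤ pr (∑ m, x m) := by
    have := hconv.leftDeriv_le_rightDeriv_of_mem_interior (x := ∑ m, x m)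
      (by rw [interior_Ici]; exact hXpos)
    rwa [(hpl'.mono Iio_subset_Iic_self).derivWithin (uniqueDiffWithinAt_Iio _),
      (hpr'.mono Ioi_subset_Ici_self).derivWithin (uniqueDiffWithinAt_Ioi _)] at this
  have hrn : pr (∑ m, x m) ≤ 0 := by
    rw [← hpr'.derivWithin (uniqueDiffOn_Ici _ _ self_mem_Ici)]
    exact (hpa.mono (Set.Ici_subset_Ici.2 hX0)).derivWithin_nonpos
  have hl0 : pl (∑ m, x m) = 0 := by
    by_contra hne
    have hneg : pl (∑ m, x m) < 0 := lt_of_le_of_ne (hle.trans hrn) hne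
    have hlt : ∀ n, 0 < x n → C' n (x n) < p (∑ m, x m) := fun n hn => by
      have := (hxc n).1 hn
      nlinarith
    obtain ⟨n, hn⟩ : ∃ n, 0 < x n := by
      by_contra! hcon
      linarith [Finset.sum_nonpos (s := Finset.univ) fun m _ => hcon m]
    have hgt : ∀ n, 0 < x n → x n < xS n := fun n hn => by
      by_contra! hcon
      have h1 := hlt n hn
      have h2 := hoS n
      rw [← heq] at h2
      have h3 := aux_grad (hC n) (hx0 n) (hxS.1 n)
      have h4 := aux_grad (hC n) (hxS.1 n) (hx0 n)
      rcases hcon.eq_or_lt with h | h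
      · rw [h] at h2; linarith
      · nlinarith
    have hXS : ∑ m, x m < ∑ m, xS m := by
      refine Finset.sum_lt_sum (fun m _ => ?_) ⟨n, Finset.mem_univ n, hgt n hn⟩
      rcases (hx0 m).eq_or_lt with h | h
      · rw [← h]; exact hxS.1 m
      · exact (hgt m h).le
    have hr0 : 0 ≤ pr (∑ m, x m) := aux_nonneg hXS hpr' fun t h1 h2 => by
      rw [heq]
      exact hpa (hX0.trans h1.le) (hX0.trans hXS.le) h2.le
    have := (hxc n).2
    have := hlt n hn
    nlinarith
  have hr0 : pr (∑ m, x m) = 0 := le_antisymm hrn (hl0 ▸ hle)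
  have hopt : SocialOptimum C p x := by
    refine ⟨hx0, fun y hy => ?_⟩
    have hY0 : 0 ≤ ∑ m, y m := Finset.sum_nonneg fun m _ => hy m
    have h1 := aux_int_s6 hpa hX0 hY0
    have h2 : ∑ m, p (∑ m, x m) * (y m - x m) ≤ ∑ m, (C m (y m) - C m (x m)) := by
      refine Finset.sum_le_sum fun n _ => ?_
      refine le_trans ?_ (aux_grad (hC n) (hx0 n) (hy n))
      have h3 := hxc n
      rw [hl0, hr0] at h3
      simp only [mul_zero, add_zero] at h3
      rcases (hx0 n).eq_or_lt with h | h
      · exact mul_le_mul_of_nonneg_right h3.2 (by linarith [hy n])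
      · rw [le_antisymm (h3.1 h) h3.2]
    rw [← Finset.mul_sum, Finset.sum_sub_distrib, Finset.sum_sub_distrib] at h2
    unfold SW
    linarith
  refine ⟨hl0, hr0, hopt, ?_⟩
  have he : SW C p x = SW C p xS := le_antisymm (hxS.2 x hx0) (hopt.2 xS hxS.1)
  rw [he]
  refine div_self fun h0 => ?_
  have hz : SW C p (fun _ => 0) = 0 := by
    unfold SW
    simp [fun n => (hC n).2.2.2.2.2.2]
  have hzo : SocialOptimum C p (fun _ => 0) :=
    ⟨fun _ => le_rfl, fun y hy => by rw [hz, ← h0]; exact hxS.2 y hy⟩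
  obtain ⟨n, hn⟩ := hA4
  have := aux_opt hC hpc hpa hzo n
  simp at this
  linarith

end
end

section
/- The bound γ(x) ≥ g(β) = 3β² − 4β + 2 for Cournot equilibria under affine inverse demand is tight: for every β ∈ [1/2, 1) and every ε > 0, there exist a number of suppliers N, cost functions satisfying Assumption 1, and an affine inverse demand function p(q) = max{b − aq, 0} with a, b > 0 and b > min_n C_n'(0), together with a Cournot equilibrium x whose associated parameter aX/(b − min_n C_n'(x_n)) equals β and whose efficiency is at most g(β) + ε. -/
open Finset Set

noncomputable section

theorem aux_int_s8 (Y : ℝ) (h1 : Y ≤ 1) (h0 : 0 ≤ Y) :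
    (∫ q in (0:ℝ)..Y, max (1 - 1 * q) 0) = Y - Y ^ 2 / 2 := by
  have : (∫ q in (0:ℝ)..Y, max (1 - 1 * q) 0) = ∫ q in (0:ℝ)..Y, (1 - q) := by
    apply intervalIntegral.integral_congr
    intro q hq
    rw [Set.uIcc_of_le h0] at hq
    have := hq.2
    simp only [one_mul]
    exact max_eq_left (by linarith)
  rw [this, intervalIntegral.integral_sub (by simp) (by simp)]
  simp

theorem aux_int_le (Y : ℝ) (h0 : 0 ≤ Y) :
    (∫ q in (0:ℝ)..Y, max (1 - 1 * q) 0) ≤ 1 / 2 := by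
  rcases le_total Y 1 with h | h
  · rw [aux_int_s8 Y h h0]
    nlinarith [sq_nonneg (Y - 1)]
  · have hc : Continuous (fun q : ℝ => max (1 - 1 * q) 0) := by fun_prop
    rw [← intervalIntegral.integral_add_adjacent_intervals (b := 1)
      (hc.intervalIntegrable _ _) (hc.intervalIntegrable _ _), aux_int_s8 1 le_rfl zero_le_one]
    have : (∫ q in (1:ℝ)..Y, max (1 - 1 * q) 0) = ∫ q in (1:ℝ)..Y, (0:ℝ) := by
      apply intervalIntegral.integral_congr
      intro q hq
      rw [Set.uIcc_of_le h] at hq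
      have := hq.1
      simp only [one_mul]
      exact max_eq_right (by linarith)
    rw [this]
    norm_num

theorem aux_cost (c : ℝ) (hc : 0 ≤ c) : CostAssumption (fun z => c * z) (fun _ => c) := by
  have hd : ∀ x : ℝ, HasDerivAt (fun z : ℝ => c * z) c x := fun x => by
    simpa using (hasDerivAt_id x).const_mul c
  refine ⟨?_, by fun_prop, ?_, fun x _ => hd x, by fun_prop, (hd 0).hasDerivWithinAt, by simp⟩
  · refine ⟨convex_Ici 0, ?_⟩
    intro x _ y _ s t _ _ _
    simp only [smul_eq_mul]
    exact le_of_eq (by ring)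
  · intro x _ y _ h
    exact mul_le_mul_of_nonneg_left h hc

/-- Tightness of the bound `g(β) = 3β² - 4β + 2` for affine inverse demand. -/
theorem affine_demand_bound_tight (β ε : ℝ)
    (hβ : 1 / 2 ≤ β ∧ β < 1) (hε : 0 < ε) :
    ∃ (N : ℕ) (C C' : Fin N → ℝ → ℝ) (a b : ℝ) (x : Fin N → ℝ),
      0 < N ∧ 0 < a ∧ 0 < b ∧
      (∀ n, CostAssumption (C n) (C' n)) ∧
      (∃ n, C' n 0 < b) ∧
      CournotEquilibrium C (fun q => max (b - a * q) 0) x ∧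
      a * (∑ n, x n) / (b - ⨅ n, C' n (x n)) = β ∧
      ∃ xS : Fin N → ℝ,
        SocialOptimum C (fun q => max (b - a * q) 0) xS ∧
        SW C (fun q => max (b - a * q) 0) x /
            SW C (fun q => max (b - a * q) 0) xS ≤
          (3 * β ^ 2 - 4 * β + 2) + ε := by
  obtain ⟨hβ1, hβ2⟩ := hβ
  have hpos : 0 < 1 - β := by linarith
  obtain ⟨M, hM⟩ := exists_nat_gt (max (2 / ε) (1 / (1 - β)))
  have hMe : 2 / ε < M := lt_of_le_of_lt (le_max_left _ _) hM
  have hMb : 1 / (1 - β) < M := lt_of_le_of_lt (le_max_right _ _) hM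
  have hM0 : (0:ℝ) < M := lt_trans (by positivity) hMe
  rw [div_lt_iff₀ hε] at hMe
  rw [div_lt_iff₀ hpos] at hMb
  obtain ⟨t, ht⟩ : ∃ t : ℝ, t = (2 * β - 1) / M := ⟨_, rfl⟩
  have hMt : M * t = 2 * β - 1 := by rw [ht]; field_simp
  have ht0 : 0 ≤ t := by rw [ht]; exact div_nonneg (by linarith) hM0.le
  have ht1 : t ≤ 1 - β := by
    rw [ht, div_le_iff₀ hM0]; linarith
  have hte : 2 * t ≤ ε := by
    rw [ht, ← mul_div_assoc, div_le_iff₀ hM0]; linarith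
  obtain ⟨x, hx⟩ : ∃ x : Fin (M + 1) → ℝ, x = Fin.cons (1 - β) (fun _ => t) := ⟨_, rfl⟩
  have hx0 : x 0 = 1 - β := by rw [hx]; rfl
  have hxs : ∀ i : Fin M, x i.succ = t := by intro i; rw [hx]; rfl
  have hxn : ∀ n, 0 ≤ x n := by
    intro n
    refine Fin.cases ?_ (fun i => ?_) n
    · rw [hx0]; exact hpos.le
    · rw [hxs]; exact ht0
  have hxle : ∀ n, x n ≤ 1 - β := by
    intro n
    refine Fin.cases ?_ (fun i => ?_) n
    · rw [hx0]
    · rw [hxs]; exact ht1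
  have hsum : ∑ n, x n = β := by
    rw [Fin.sum_univ_succ, hx0]
    simp only [hxs, Finset.sum_const, Finset.card_univ, Fintype.card_fin, nsmul_eq_mul]
    linarith
  have hinf : (⨅ n, (1 - β - x n)) = 0 := by
    apply le_antisymm
    · have := ciInf_le (f := fun n => 1 - β - x n) (Set.finite_range _).bddBelow 0
      simpa [hx0] using this
    · exact le_ciInf fun n => by linarith [hxle n]
  have hSx : SW (fun n z => (1 - β - x n) * z) (fun q => max (1 - 1 * q) 0) x
      = β - β ^ 2 / 2 - (2 * β - 1) * (1 - β - t) := by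
    unfold SW
    rw [hsum, aux_int_s8 β hβ2.le (by linarith), Fin.sum_univ_succ]
    simp only [hx0, hxs, Finset.sum_const, Finset.card_univ, Fintype.card_fin, nsmul_eq_mul]
    rw [← hMt]; ring
  have hSS : SW (fun n z => (1 - β - x n) * z) (fun q => max (1 - 1 * q) 0)
      (Fin.cons 1 (fun _ => 0) : Fin (M + 1) → ℝ) = 1 / 2 := by
    unfold SW
    have h1 : ∑ n, (Fin.cons 1 (fun _ => 0) : Fin (M + 1) → ℝ) n = 1 := by
      simp [Fin.sum_univ_succ]
    rw [h1, aux_int_s8 1 le_rfl zero_le_one, Fin.sum_univ_succ]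
    simp only [hx0, Fin.cons_zero, Fin.cons_succ]
    norm_num
  refine ⟨M + 1, fun n z => (1 - β - x n) * z, fun n _ => 1 - β - x n, 1, 1, x,
    Nat.succ_pos _, one_pos, one_pos, fun n => aux_cost _ (by linarith [hxle n]),
    ⟨0, by simp only [hx0]; norm_num⟩, ⟨hxn, ?_⟩, ?_,
    (Fin.cons 1 (fun _ => 0) : Fin (M + 1) → ℝ), ⟨?_, ?_⟩, ?_⟩
  · intro n z hz
    have hS : ∑ m ∈ Finset.univ.erase n, x m = β - x n := by
      rw [← hsum, ← Finset.add_sum_erase _ x (Finset.mem_univ n)]; ring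
    simp only [hS]
    have e : max (1 - 1 * (x n + (β - x n))) 0 = 1 - β := by
      rw [max_eq_left] <;> linarith
    rw [e]
    have h1 := hxle n
    rcases le_total (1 - 1 * (z + (β - x n))) 0 with h | h
    · rw [max_eq_right h]
      nlinarith [mul_nonneg (sub_nonneg.2 h1) hz, sq_nonneg (x n)]
    · rw [max_eq_left h]
      nlinarith [sq_nonneg (z - x n)]
  · simp only [hinf, hsum]; norm_num
  · intro n
    refine Fin.cases ?_ (fun i => ?_) n <;> simp
  · intro y hy
    rw [hSS]
    unfold SW
    have h1 := aux_int_le (∑ n, y n) (Finset.sum_nonneg fun n _ => hy n)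
    have h2 : 0 ≤ ∑ n, (1 - β - x n) * y n :=
      Finset.sum_nonneg fun n _ => mul_nonneg (by linarith [hxle n]) (hy n)
    linarith
  · rw [hSS, hSx]
    rw [div_le_iff₀ (by norm_num)]
    nlinarith [mul_nonneg ht0 hpos.le]


end
end

section
/- Suppose Assumptions 1–4 hold and the inverse demand function p is convex. Let x be a Cournot candidate with aggregate supply X and let x^S be a social optimum with aggregate supply X^S, with p(X) ≠ p(X^S); let c = |p'(X)|. Define the piecewise linear function p⁰ by p⁰(q) = −c(q − X) + p(X) for 0 ≤ q ≤ X, and p⁰(q) = max{0, ((p(X^S) − p(X))/(X^S − X))·(q − X) + p(X)} for q > X. Then, in the modified model with inverse demand function p⁰ (and the same cost functions), the vector x^S remains socially optimal, and the efficiency γ⁰(x) of x in the modified model satisfies γ⁰(x) ≤ γ(x), where γ(x) is the efficiency of x in the original model. -/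
open Finset Set

noncomputable section

theorem aux_int_ge {p : ℝ → ℝ} (hp : AntitoneOn p (Set.Ici 0)) {a b : ℝ} (ha : 0 ≤ a) (hb : 0 ≤ b) :
    p b * (b - a) ≤ ∫ q in a..b, p q := by
  have hint : ∀ u v : ℝ, 0 ≤ u → 0 ≤ v → IntervalIntegrable p MeasureTheory.volume u v := by
    intro u v hu hv
    apply AntitoneOn.intervalIntegrable
    exact hp.mono fun z hz => le_trans (le_min hu hv) hz.1
  rcases le_total a b with h | h
  · have := intervalIntegral.integral_mono_on h (intervalIntegrable_const (c := p b)) (hint a b ha hb)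
      (fun z hz => hp (ha.trans hz.1) hb hz.2)
    simp at this
    linarith
  · have := intervalIntegral.integral_mono_on h (hint b a hb ha) (intervalIntegrable_const (c := p b))
      (fun z hz => hp hb (hb.trans hz.1) hz.1)
    rw [intervalIntegral.integral_symm]
    simp at this
    linarith

theorem aux_int_le_s9 {p : ℝ → ℝ} (hp : AntitoneOn p (Set.Ici 0)) {a b : ℝ} (ha : 0 ≤ a) (hb : 0 ≤ b) :
    ∫ q in a..b, p q ≤ p a * (b - a) := by
  have := aux_int_ge hp hb ha
  rw [intervalIntegral.integral_symm] at this
  linarith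

theorem aux_ii {p : ℝ → ℝ} (hp : AntitoneOn p (Set.Ici 0)) {a b : ℝ} (ha : 0 ≤ a) (hb : 0 ≤ b) :
    IntervalIntegrable p MeasureTheory.volume a b := by
  apply AntitoneOn.intervalIntegrable
  exact hp.mono fun z hz => le_trans (le_min ha hb) hz.1

theorem aux_foc {N : ℕ} {C : Fin N → ℝ → ℝ} {p : ℝ → ℝ} {s : Fin N → ℝ}
    (hC : ∀ n, ConvexOn ℝ (Set.Ici 0) (C n)) (hp : AntitoneOn p (Set.Ici 0))
    (hpc : ContinuousOn p (Set.Ici 0)) (hs : SocialOptimum C p s) (n : Fin N) (z : ℝ) (hz : 0 ≤ z) :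
    p (∑ m, s m) * (z - s n) ≤ C n z - C n (s n) := by
  obtain ⟨h0, hopt⟩ := hs
  set S := ∑ m, s m with hS
  have hS0 : 0 ≤ S := Finset.sum_nonneg fun m _ => h0 m
  have hsn : s n ≤ S := Finset.single_le_sum (fun m _ => h0 m) (Finset.mem_univ n)
  set δ := z - s n with hδ
  have hnn : ∀ t ∈ Set.Ioc (0:ℝ) 1, 0 ≤ s n + t * δ := by
    intro t ht
    have : s n + t * δ = (1 - t) * s n + t * z := by rw [hδ]; ring
    rw [this]
    exact add_nonneg (mul_nonneg (by linarith [ht.2]) (h0 n)) (mul_nonneg ht.1.le hz)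
  have key : ∀ t ∈ Set.Ioc (0:ℝ) 1, p (S + t * δ) * δ ≤ C n z - C n (s n) := by
    intro t ht
    have h1 := hopt (Function.update s n (s n + t * δ)) (by
      intro m
      by_cases hm : m = n
      · subst hm; simpa using hnn t ht
      · simpa [hm] using h0 m)
    have hsum : ∑ m, Function.update s n (s n + t * δ) m = S + t * δ := by
      rw [Finset.sum_update_of_mem (Finset.mem_univ n), hS,
        ← Finset.add_sum_erase _ _ (Finset.mem_univ n), Finset.sdiff_singleton_eq_erase]
      ring
    have hcost : ∑ m, C m (Function.update s n (s n + t * δ) m)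
        = ∑ m, C m (s m) + (C n (s n + t * δ) - C n (s n)) := by
      rw [← Finset.add_sum_erase _ _ (Finset.mem_univ n),
        ← Finset.add_sum_erase (f := fun m => C m (s m)) _ (Finset.mem_univ n)]
      have : ∑ m ∈ Finset.univ.erase n, C m (Function.update s n (s n + t * δ) m)
          = ∑ m ∈ Finset.univ.erase n, C m (s m) :=
        Finset.sum_congr rfl fun m hm => by
          rw [Function.update_of_ne (Finset.ne_of_mem_erase hm)]
      rw [this]
      simp
      ring
    unfold SW at h1
    rw [hsum, hcost, ← hS] at h1
    have hSt : 0 ≤ S + t * δ := by linarith [hnn t ht]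
    have h2 := intervalIntegral.integral_add_adjacent_intervals (aux_ii hp le_rfl hS0)
      (aux_ii hp hS0 hSt)
    have h3 := aux_int_ge hp hS0 hSt
    have h4 := (hC n).2 (h0 n) hz (show 0 ≤ 1 - t by linarith [ht.2]) ht.1.le (by ring)
    simp only [smul_eq_mul] at h4
    rw [show (1 - t) * s n + t * z = s n + t * δ by rw [hδ]; ring] at h4
    have h5 : t * (p (S + t * δ) * δ) ≤ t * (C n z - C n (s n)) := by nlinarith
    exact le_of_mul_le_mul_left h5 ht.1
  have hlim : Filter.Tendsto (fun t : ℝ => p (S + t * δ) * δ) (nhdsWithin 0 (Set.Ioc 0 1))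
      (nhds (p S * δ)) := by
    apply Filter.Tendsto.mul_const
    have := (hpc S hS0).tendsto
    refine this.comp (tendsto_nhdsWithin_iff.2 ⟨?_, ?_⟩)
    · have : Filter.Tendsto (fun t : ℝ => S + t * δ) (nhds 0) (nhds (S + 0 * δ)) := by
        apply Continuous.tendsto; fun_prop
      simp at this
      exact this.mono_left nhdsWithin_le_nhds
    · filter_upwards [self_mem_nhdsWithin] with t ht
      have := hnn t ht
      simp only [Set.mem_Ici]; linarith
  have : (nhdsWithin (0:ℝ) (Set.Ioc 0 1)).NeBot := by
    rw [nhdsWithin_Ioc_eq_nhdsGT (zero_lt_one)]; infer_instance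
  exact le_of_tendsto hlim (by filter_upwards [self_mem_nhdsWithin] with t ht using key t ht)

theorem aux_tangent_s9 {p : ℝ → ℝ} {d X q : ℝ} (hp : ConvexOn ℝ (Set.Ici 0) p)
    (hd : HasDerivWithinAt p d (Set.Ici X) X) (hq : 0 ≤ q) (hqX : q ≤ X) :
    d * (q - X) + p X ≤ p q := by
  rcases hqX.eq_or_lt with rfl | h
  · simp
  have h1 := (hasDerivWithinAt_iff_tendsto_slope.1 hd)
  have h2 : (p X - p q) / (X - q) ≤ d := by
    have hb : (nhdsWithin X (Set.Ici X \ {X})).NeBot := by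
      rw [Set.Ici_sdiff_left]; infer_instance
    refine ge_of_tendsto h1 ?_
    filter_upwards [self_mem_nhdsWithin] with r hr
    have hr' : X < r := lt_of_le_of_ne hr.1 (fun h => hr.2 h.symm)
    have := hp.slope_mono_adjacent (x := q) (y := X) (z := r) hq
      (show (0:ℝ) ≤ r by linarith) h hr'
    rw [slope_def_field]; exact this
  rw [div_le_iff₀ (by linarith)] at h2
  linarith

theorem aux_deriv_le {C : ℝ → ℝ} {d a b : ℝ} (hC : ConvexOn ℝ (Set.Ici 0) C) (ha : 0 ≤ a)
    (hab : a < b) (hd : HasDerivAt C d b) : C b - C a ≤ d * (b - a) := by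
  have := aux_tangent_s9 hC (hd.hasDerivWithinAt (s := Set.Ici b)) ha hab.le
  linarith

theorem aux_nonpos_left {p : ℝ → ℝ} {d X : ℝ} (hp : AntitoneOn p (Set.Ici 0)) (hX : 0 < X)
    (hd : HasDerivWithinAt p d (Set.Iic X) X) : d ≤ 0 := by
  have h1 := (hasDerivWithinAt_iff_tendsto_slope.1 hd)
  have hb : (nhdsWithin X (Set.Iic X \ {X})).NeBot := by
    rw [Set.Iic_sdiff_right]; infer_instance
  refine le_of_tendsto h1 ?_
  filter_upwards [self_mem_nhdsWithin, mem_nhdsWithin_of_mem_nhds (Ioi_mem_nhds hX)] with r hr hr0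
  rw [slope_def_field]
  exact div_nonpos_of_nonneg_of_nonpos (sub_nonneg.2 (hp (Set.Ioi_subset_Ici_self hr0) hX.le hr.1)) (sub_nonpos.2 hr.1)

theorem aux_nonpos_right {p : ℝ → ℝ} {d X : ℝ} (hp : AntitoneOn p (Set.Ici 0)) (hX : 0 ≤ X)
    (hd : HasDerivWithinAt p d (Set.Ici X) X) : d ≤ 0 := by
  have h1 := (hasDerivWithinAt_iff_tendsto_slope.1 hd)
  have hb : (nhdsWithin X (Set.Ici X \ {X})).NeBot := by
    rw [Set.Ici_sdiff_left]; infer_instance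
  refine le_of_tendsto h1 ?_
  filter_upwards [self_mem_nhdsWithin] with r hr
  rw [slope_def_field]
  exact div_nonpos_of_nonpos_of_nonneg (sub_nonpos.2 (hp hX (hX.trans hr.1) hr.1))
    (sub_nonneg.2 hr.1)

theorem aux_chord {p : ℝ → ℝ} {X S q : ℝ} (hp : ConvexOn ℝ (Set.Ici 0) p) (hX : 0 ≤ X)
    (h1 : X < S) (hq : X ≤ q) (hq2 : q ≤ S) :
    p q ≤ (p S - p X) / (S - X) * (q - X) + p X := by
  have hd : 0 < S - X := by linarith
  have h4 := hp.2 hX (hX.trans h1.le)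
    (show 0 ≤ (S - q) / (S - X) from div_nonneg (by linarith) hd.le)
    (show 0 ≤ (q - X) / (S - X) from div_nonneg (by linarith) hd.le)
    (by field_simp; ring)
  simp only [smul_eq_mul] at h4
  rw [show (S - q) / (S - X) * X + (q - X) / (S - X) * S = q by field_simp; ring] at h4
  refine h4.trans (le_of_eq ?_)
  field_simp
  ring

theorem aux_ratio {a b A B w : ℝ} (ha : 0 ≤ a) (hab : a ≤ b) (hA : 0 ≤ A) (hB : 0 ≤ B)
    (hw : w = b + A - B) (haw : a + A ≤ w) : a / b ≤ (a + A) / w := by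
  rcases (ha.trans hab).eq_or_lt with hb | hb
  · rw [← hb]; simp; exact div_nonneg (by linarith) (by linarith)
  rcases (show 0 ≤ w by linarith).eq_or_lt with h | h
  · have : a = 0 := by linarith
    rw [this, ← h]; simp
  rw [div_le_div_iff₀ hb h]
  nlinarith [mul_le_mul_of_nonneg_right hab hA, mul_nonneg ha hB]

/-- Replacing a convex inverse demand function by the piecewise linear function `p⁰`
keeps `x^S` socially optimal and cannot increase the efficiency of `x`. -/
theorem piecewise_linear_demand_lowers_efficiency {N : ℕ} (hN : 0 < N)
    (C C' : Fin N → ℝ → ℝ) (p pl pr : ℝ → ℝ)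
    (hC : ∀ n, CostAssumption (C n) (C' n))
    (hp : DemandAssumption p pl pr)
    (hA3 : ∃ R : ℝ, 0 < R ∧ ∀ n, p R ≤ C' n 0)
    (hA4 : ∃ n, C' n 0 < p 0)
    (hconv : ConvexOn ℝ (Set.Ici 0) p)
    (x xS : Fin N → ℝ)
    (hx : CournotCandidate C' p pl pr x)
    (hxS : SocialOptimum C p xS)
    (hne : p (∑ n, x n) ≠ p (∑ n, xS n))
    (c : ℝ) (hc : c = |pr (∑ n, x n)|)
    (p0 : ℝ → ℝ)
    (hp0 : ∀ q : ℝ, p0 q =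
      if q ≤ ∑ n, x n then
        -c * (q - ∑ n, x n) + p (∑ n, x n)
      else
        max 0 ((p (∑ n, xS n) - p (∑ n, x n)) / ((∑ n, xS n) - ∑ n, x n) *
          (q - ∑ n, x n) + p (∑ n, x n))) :
    SocialOptimum C p0 xS ∧
    SW C p0 x / SW C p0 xS ≤ SW C p x / SW C p xS := by
  obtain ⟨hpc, hpn, hpa, -, hpr0, hpr, hpl⟩ := hp
  have hCc : ∀ n, ConvexOn ℝ (Set.Ici 0) (C n) := fun n => (hC n).1
  have hX0 : 0 ≤ ∑ n, x n := Finset.sum_nonneg fun m _ => hx.1 m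
  have hS0 : 0 ≤ ∑ n, xS n := Finset.sum_nonneg fun m _ => hxS.1 m
  have hfoc := aux_foc hCc hpa hpc hxS
  have hCx : ∀ n, 0 < x n → C' n (x n) ≤ p (∑ n, x n) := by
    intro n hn
    have h1 := (hx.2 n).1 hn
    have hXp : 0 < ∑ n, x n :=
      hn.trans_le (Finset.single_le_sum (fun m _ => hx.1 m) (Finset.mem_univ n))
    have h2 := aux_nonpos_left hpa hXp (hpl _ hXp)
    nlinarith
  have hdr : HasDerivWithinAt p (pr (∑ n, x n)) (Set.Ici (∑ n, x n)) (∑ n, x n) := by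
    rcases hX0.eq_or_lt with h | h
    · rw [← h]; exact hpr0
    · exact hpr _ h
  have hlt : p (∑ n, xS n) < p (∑ n, x n) := by
    refine lt_of_le_of_ne ?_ hne.symm
    by_contra! hcon
    have hSX : ∑ n, xS n < ∑ n, x n := by
      by_contra! h
      exact absurd (hpa hX0 hS0 h) (not_le.2 hcon)
    obtain ⟨n, -, hn⟩ := Finset.exists_lt_of_sum_lt hSX
    have hxn : 0 < x n := (hxS.1 n).trans_lt hn
    have h1 := hfoc n (x n) (hx.1 n)
    have h2 := aux_deriv_le (hCc n) (hxS.1 n) hn ((hC n).2.2.2.1 _ hxn)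
    have h3 := hCx n hxn
    nlinarith
  have hCxx : ∑ n, C n (x n) ≤ p (∑ n, x n) * ∑ n, x n := by
    rw [Finset.mul_sum]
    refine Finset.sum_le_sum fun n _ => ?_
    have hC0 : C n 0 = 0 := (hC n).2.2.2.2.2.2
    rcases (hx.1 n).eq_or_lt with h | h
    · rw [← h, hC0]; simp
    · have h2 := aux_deriv_le (hCc n) le_rfl h ((hC n).2.2.2.1 _ h)
      have h3 := hCx n h
      nlinarith
  have hXS : ∑ n, x n < ∑ n, xS n := by
    by_contra! h
    exact absurd (hpa hS0 hX0 h) (not_le.2 hlt)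
  have hc' : c = - pr (∑ n, x n) := by
    rw [hc, abs_of_nonpos (aux_nonpos_right hpa hX0 hdr)]
  have hc0 : 0 ≤ c := hc ▸ abs_nonneg _
  have hxnn := hx.1
  have hsnn := hxS.1
  set X := ∑ n, x n with hXdef
  set S := ∑ n, xS n with hSdef
  set m := (p S - p X) / (S - X) with hm
  have hm0 : m ≤ 0 := div_nonpos_of_nonpos_of_nonneg (by linarith) (by linarith)
  have hanti : Antitone p0 := by
    intro u v huv
    rw [hp0, hp0]
    have hpX := hpn X hX0
    split_ifs with h1 h2 h2
    · nlinarith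
    · exact absurd (huv.trans h1) h2
    · refine max_le ?_ ?_ <;> nlinarith
    · exact max_le_max le_rfl (by nlinarith)
  have hantiOn : AntitoneOn p0 (Set.Ici 0) := hanti.antitoneOn _
  have hp0S : p0 S = p S := by
    rw [hp0, if_neg (not_le.2 hXS), hm, div_mul_cancel₀ _ (by linarith)]
    simp [hpn S hS0]
  have hp0X : p0 X = p X := by
    rw [hp0, if_pos le_rfl]; simp
  have hopt0 : SocialOptimum C p0 xS := by
    refine ⟨hsnn, fun y hy => ?_⟩
    have hY0 : 0 ≤ ∑ n, y n := Finset.sum_nonneg fun m _ => hy m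
    have h1 := aux_int_le_s9 hantiOn hS0 hY0
    have h2 := intervalIntegral.integral_add_adjacent_intervals (aux_ii hantiOn le_rfl hS0)
      (aux_ii hantiOn hS0 hY0)
    have h3 : ∑ n, p S * (y n - xS n) ≤ ∑ n, (C n (y n) - C n (xS n)) :=
      Finset.sum_le_sum fun n _ => hfoc n (y n) (hy n)
    rw [← Finset.mul_sum, Finset.sum_sub_distrib, Finset.sum_sub_distrib, ← hSdef] at h3
    rw [hp0S] at h1
    unfold SW
    rw [← hSdef]
    linarith
  refine ⟨hopt0, ?_⟩
  have hA : ∫ q in (0:ℝ)..X, p0 q ≤ ∫ q in (0:ℝ)..X, p q := by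
    refine intervalIntegral.integral_mono_on hX0 (aux_ii hantiOn le_rfl hX0)
      (aux_ii hpa le_rfl hX0) fun q hq => ?_
    rw [hp0, if_pos hq.2, hc', neg_neg]
    exact aux_tangent_s9 hconv hdr hq.1 hq.2
  have hB : ∫ q in X..S, p q ≤ ∫ q in X..S, p0 q := by
    refine intervalIntegral.integral_mono_on hXS.le (aux_ii hpa hX0 hS0)
      (aux_ii hantiOn hX0 hS0) fun q hq => ?_
    rcases hq.1.eq_or_lt with h | h
    · rw [← h, hp0X]
    rw [hp0, if_neg (not_le.2 h)]
    exact le_max_of_le_right (aux_chord hconv hX0 hXS hq.1 hq.2)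
  have hs1 := intervalIntegral.integral_add_adjacent_intervals (aux_ii hantiOn le_rfl hX0)
      (aux_ii hantiOn hX0 hS0)
  have hs2 := intervalIntegral.integral_add_adjacent_intervals (aux_ii hpa le_rfl hX0)
      (aux_ii hpa hX0 hS0)
  have ha : 0 ≤ SW C p0 x := by
    have := aux_int_ge hantiOn le_rfl hX0
    unfold SW
    rw [← hXdef]
    rw [hp0X] at this
    linarith
  have e1 : SW C p x = SW C p0 x + ((∫ q in (0:ℝ)..X, p q) - ∫ q in (0:ℝ)..X, p0 q) := by
    unfold SW; rw [← hXdef]; ring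
  have h6 := hxS.2 x hxnn
  rw [e1] at h6 ⊢
  refine aux_ratio (B := (∫ q in X..S, p0 q) - ∫ q in X..S, p q) ha (hopt0.2 x hxnn)
    (by linarith) (by linarith) ?_ h6
  unfold SW; rw [← hSdef]; linarith


end
end

section
/- Suppose Assumptions 1–4 hold and the inverse demand function p is convex. Suppose also that p(Q) = 0 for some Q > 0 and that the ratio μ = ∂₊p(0)/∂₋p(Q) is finite (in particular ∂₋p(Q) < 0). Then the efficiency of every Cournot candidate is at least f(μ). -/
open Finset Set

noncomputable section

lemma one_le_phi (c : ℝ) : 1 ≤ phi c := le_max_right _ _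

lemma fbound_pos {c : ℝ} (hc : 0 ≤ c) : 0 < fbound c := by
  have := one_le_phi c
  unfold fbound; positivity

lemma fbound_le_one {c : ℝ} (hc : 0 ≤ c) : fbound c ≤ 1 := by
  have := one_le_phi c
  unfold fbound
  rw [div_le_one (by positivity)]
  linarith

lemma fbound_key1 {c t : ℝ} (hc : 0 ≤ c) (ht : 1 ≤ t) :
    fbound c * (t ^ 2 + 2 * t + c) ≤ t ^ 2 + 2 := by
  have h1 := one_le_phi c
  unfold fbound
  rw [div_mul_eq_mul_div, div_le_iff₀ (by positivity)]
  have hs : 0 ≤ c ^ 2 - 4 * c + 12 := by nlinarith [sq_nonneg (c - 2)]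
  have hsq := Real.sq_sqrt hs
  have hs0 := Real.sqrt_nonneg (c ^ 2 - 4 * c + 12)
  set s := Real.sqrt (c ^ 2 - 4 * c + 12)
  suffices h : 0 ≤ (t - phi c) * ((c - 2) * (t + phi c) + 2 * t * phi c - 4) by
    nlinarith
  rcases le_total 1 ((2 - c + s) / 2) with h | h
  · have e : phi c = (2 - c + s) / 2 := max_eq_left h
    have e2 : (c - 2) * (t + phi c) + 2 * t * phi c - 4 = (t - phi c) * s := by
      rw [e]; nlinarith
    rw [e2]
    nlinarith [mul_nonneg (sq_nonneg (t - phi c)) hs0]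
  · have e : phi c = 1 := max_eq_right h
    have hc3 : 3 ≤ c := by nlinarith
    rw [e]
    apply mul_nonneg (by linarith)
    nlinarith

lemma fbound_key {c X a : ℝ} (hc : 0 ≤ c) (ha : 0 < a) (hX : a ≤ X) :
    fbound c * (X ^ 2 + 2 * a * X + c * a ^ 2) ≤ X ^ 2 + 2 * a ^ 2 := by
  have h := fbound_key1 (t := X / a) hc ((one_le_div ha).2 hX)
  have h2 := mul_le_mul_of_nonneg_right h (sq_nonneg a)
  have e1 : fbound c * ((X / a) ^ 2 + 2 * (X / a) + c) * a ^ 2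
      = fbound c * (X ^ 2 + 2 * a * X + c * a ^ 2) := by field_simp
  have e2 : ((X / a) ^ 2 + 2) * a ^ 2 = X ^ 2 + 2 * a ^ 2 := by field_simp
  linarith

lemma tan_right {f : ℝ → ℝ} (hf : ConvexOn ℝ (Set.Ici 0) f) {x y r : ℝ} (hx : 0 ≤ x)
    (h : HasDerivWithinAt f r (Set.Ici x) x) (hxy : x ≤ y) : f x + r * (y - x) ≤ f y := by
  rcases hxy.eq_or_lt with rfl | hlt
  · simp
  have := hf.le_slope_of_hasDerivWithinAt_Ioi hx (hx.trans hxy) hlt (h.mono Set.Ioi_subset_Ici_self)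
  rw [slope_def_field, le_div_iff₀ (by linarith)] at this
  linarith

lemma tan_left {f : ℝ → ℝ} (hf : ConvexOn ℝ (Set.Ici 0) f) {x y r : ℝ} (hy : 0 ≤ y)
    (h : HasDerivWithinAt f r (Set.Iic x) x) (hxy : y ≤ x) : f x + r * (y - x) ≤ f y := by
  rcases hxy.eq_or_lt with rfl | hlt
  · simp
  have := hf.slope_le_of_hasDerivWithinAt_Iio hy (hy.trans hxy) hlt (h.mono Set.Iio_subset_Iic_self)
  rw [slope_def_field, div_le_iff₀ (by linarith)] at this
  linarith

lemma left_le_right {f : ℝ → ℝ} (hf : ConvexOn ℝ (Set.Ici 0) f) {x l r : ℝ} (hx : 0 < x)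
    (hl : HasDerivWithinAt f l (Set.Iic x) x) (hr : HasDerivWithinAt f r (Set.Ici x) x) :
    l ≤ r := by
  have := hf.leftDeriv_le_rightDeriv_of_mem_interior (x := x) (by simpa using hx)
  rwa [(hl.mono Set.Iio_subset_Iic_self).derivWithin (uniqueDiffWithinAt_Iio x),
    (hr.mono Set.Ioi_subset_Ici_self).derivWithin (uniqueDiffWithinAt_Ioi x)] at this

lemma integ {p : ℝ → ℝ} (hp : ContinuousOn p (Set.Ici 0)) {u v : ℝ} (hu : 0 ≤ u) (hv : 0 ≤ v) :
    IntervalIntegrable p MeasureTheory.volume u v := by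
  apply (hp.mono ?_).intervalIntegrable
  intro z hz
  rw [Set.mem_uIcc] at hz
  simp only [Set.mem_Ici]
  rcases hz with h | h <;> linarith [h.1]

lemma int_lin (A B u v w : ℝ) :
    ∫ q in u..v, (A + B * (q - w)) = A * (v - u) + B * ((v - w) ^ 2 - (u - w) ^ 2) / 2 := by
  rw [intervalIntegral.integral_eq_sub_of_hasDerivAt
    (f := fun q => A * q + B * (q - w) ^ 2 / 2)]
  · ring
  · intro q _
    have h := ((hasDerivAt_id q).const_mul A).add
      (((((hasDerivAt_id q).sub_const w).pow 2).const_mul B).div_const 2)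
    exact h.congr_deriv (by simp; ring)
  · exact (by fun_prop : Continuous fun q => A + B * (q - w)).intervalIntegrable _ _

lemma int_ge {p : ℝ → ℝ} (hp : ContinuousOn p (Set.Ici 0)) {u v : ℝ} (A B w : ℝ) (hu : 0 ≤ u)
    (huv : u ≤ v) (h : ∀ q, u ≤ q → q ≤ v → A + B * (q - w) ≤ p q) :
    A * (v - u) + B * ((v - w) ^ 2 - (u - w) ^ 2) / 2 ≤ ∫ q in u..v, p q := by
  rw [← int_lin]
  apply intervalIntegral.integral_mono_on huv
  · exact (by fun_prop : Continuous fun q => A + B * (q - w)).intervalIntegrable _ _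
  · exact integ hp hu (hu.trans huv)
  · intro q hq; exact h q hq.1 hq.2

lemma int_le {p : ℝ → ℝ} (hp : ContinuousOn p (Set.Ici 0)) {u v : ℝ} (A B w : ℝ) (hu : 0 ≤ u)
    (huv : u ≤ v) (h : ∀ q, u ≤ q → q ≤ v → p q ≤ A + B * (q - w)) :
    ∫ q in u..v, p q ≤ A * (v - u) + B * ((v - w) ^ 2 - (u - w) ^ 2) / 2 := by
  rw [← int_lin]
  apply intervalIntegral.integral_mono_on huv
  · exact integ hp hu (hu.trans huv)
  · exact (by fun_prop : Continuous fun q => A + B * (q - w)).intervalIntegrable _ _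
  · intro q hq; exact h q hq.1 hq.2

lemma quad_bd {c a d t : ℝ} (hd : 0 < d) :
    c * a * t + -d * t ^ 2 / 2 ≤ c ^ 2 * a ^ 2 / (2 * d) := by
  rw [le_div_iff₀ (by positivity)]
  nlinarith [sq_nonneg (c * a - d * t)]

lemma ctan {C C' : ℝ → ℝ} (h : CostAssumption C C') {x y : ℝ} (hx : 0 ≤ x) (hy : 0 ≤ y) :
    C x + C' x * (y - x) ≤ C y := by
  obtain ⟨hcv, -, -, hd, -, h0, -⟩ := h
  rcases hx.eq_or_lt with rfl | hlt
  · exact tan_right hcv le_rfl h0 hy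
  rcases le_total x y with hxy | hxy
  · exact tan_right hcv hx (hd x hlt).hasDerivWithinAt hxy
  · exact tan_left hcv hy (hd x hlt).hasDerivWithinAt hxy

set_option maxHeartbeats 2000000 in
/-- If `p(Q) = 0` and the ratio `μ = ∂₊p(0)/∂₋p(Q)` is finite, then the efficiency
of every Cournot candidate is at least `f(μ)`. -/
theorem efficiency_bound_mu {N : ℕ} (hN : 0 < N)
    (C C' : Fin N → ℝ → ℝ) (p pl pr : ℝ → ℝ)
    (hC : ∀ n, CostAssumption (C n) (C' n))
    (hp : DemandAssumption p pl pr)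
    (hA3 : ∃ R : ℝ, 0 < R ∧ ∀ n, p R ≤ C' n 0)
    (hA4 : ∃ n, C' n 0 < p 0)
    (hconv : ConvexOn ℝ (Set.Ici 0) p)
    (Q : ℝ) (hQ : 0 < Q) (hpQ : p Q = 0)
    (hplQ : pl Q < 0)
    (μ : ℝ) (hμ : μ = pr 0 / pl Q) :
    ∀ x xS : Fin N → ℝ, CournotCandidate C' p pl pr x →
      SocialOptimum C p xS →
      fbound μ ≤ SW C p x / SW C p xS := by
  intro x xS ⟨hx0, hxc⟩ ⟨hS0, hSopt⟩
  obtain ⟨hpc, hpnn, hpanti, hp0, hpr0, hprd, hpld⟩ := hp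
  have hpr0neg : pr 0 < 0 := by
    have := tan_right hconv le_rfl hpr0 hQ.le
    rw [hpQ] at this
    by_contra hcon
    have : 0 ≤ pr 0 * (Q - 0) := mul_nonneg (not_lt.1 hcon) (by linarith)
    linarith
  have hμ0 : 0 ≤ μ := by rw [hμ]; exact (div_pos_of_neg_of_neg hpr0neg hplQ).le
  have hF0 := fbound_pos hμ0
  have hF1 := fbound_le_one hμ0
  have hμδ : μ * pl Q = pr 0 := by rw [hμ, div_mul_cancel₀ _ hplQ.ne]
  have htanQ : ∀ q, 0 ≤ q → q ≤ Q → pl Q * (q - Q) ≤ p q := by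
    intro q h0 h1
    have := tan_left hconv h0 (hpld Q hQ) h1
    rw [hpQ] at this
    linarith
  have hpos : 0 < ∫ q in (0:ℝ)..Q, p q := by
    have := int_ge hpc 0 (pl Q) Q le_rfl hQ.le (fun q h0 h1 => by
      have := htanQ q h0 h1; linarith)
    have h2 : 0 < Q ^ 2 := by positivity
    nlinarith
  set X := ∑ n, x n with hXdef
  have hX0' : 0 ≤ X := Finset.sum_nonneg fun n _ => hx0 n
  have hX0 : 0 < X := by
    rcases hX0'.eq_or_lt with h | h
    · exfalso
      have hz : ∀ n, x n = 0 := by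
        intro n
        exact (Finset.sum_eq_zero_iff_of_nonneg (fun n _ => hx0 n)).1 h.symm n (Finset.mem_univ n)
      obtain ⟨n, hn⟩ := hA4
      have := (hxc n).2
      rw [hz n, ← h] at this
      linarith
    · exact h
  have hlr := left_le_right hconv hX0 (hpld X hX0) (hprd X hX0)
  have htanX : ∀ q, 0 ≤ q → p X + pl X * (q - X) ≤ p q := by
    intro q hq
    rcases le_total q X with h | h
    · exact tan_left hconv hq (hpld X hX0) h
    · have := tan_right hconv hX0' (hprd X hX0) h
      nlinarith [mul_le_mul_of_nonneg_right hlr (sub_nonneg.2 h)]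
  have hpl0 : pl X ≤ 0 := by
    have h1 := htanX (X + 1) (by linarith)
    have h2 := hpanti (show X ∈ Set.Ici 0 from hX0') (show X + 1 ∈ Set.Ici 0 from by
      simp only [Set.mem_Ici]; linarith) (by linarith)
    linarith
  have hCz : ∀ n, C n 0 = 0 := fun n => (hC n).2.2.2.2.2.2
  have hCnn : ∀ n y, 0 ≤ y → 0 ≤ C n y := by
    intro n y hy
    have := (hC n).2.2.1 (show (0:ℝ) ∈ Set.Ici 0 from Set.self_mem_Ici) (show y ∈ Set.Ici 0 from hy) hy
    rwa [hCz n] at this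
  have hCle : ∀ n, C n (x n) ≤ C' n (x n) * x n := by
    intro n
    have := ctan (hC n) (hx0 n) le_rfl
    rw [hCz n] at this
    linarith
  have hC'le : ∀ n, C' n (x n) * x n ≤ p X * x n + pl X * (x n) ^ 2 := by
    intro n
    rcases (hx0 n).eq_or_lt with h | h
    · rw [← h]; simp
    · have := mul_le_mul_of_nonneg_right ((hxc n).1 h) h.le
      nlinarith
  have hC'ge : ∀ n, p X + x n * pl X ≤ C' n (x n) := by
    intro n
    have := (hxc n).2
    nlinarith [mul_le_mul_of_nonneg_left hlr (hx0 n)]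
  set Y := ∑ n, xS n with hYdef
  have hY0 : 0 ≤ Y := Finset.sum_nonneg fun n _ => hS0 n
  have hII : ∀ u v : ℝ, 0 ≤ u → 0 ≤ v →
      (∫ q in (0:ℝ)..v, p q) = (∫ q in (0:ℝ)..u, p q) + ∫ q in u..v, p q := by
    intro u v hu hv
    rw [intervalIntegral.integral_add_adjacent_intervals (integ hpc le_rfl hu) (integ hpc hu hv)]
  have hInn : ∀ u v : ℝ, 0 ≤ u → u ≤ v → 0 ≤ ∫ q in u..v, p q := by
    intro u v hu huv
    exact intervalIntegral.integral_nonneg huv fun q hq => hpnn q (hu.trans hq.1)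
  have hSWle : SW C p x ≤ SW C p xS := hSopt x hx0
  have hSWx : SW C p x = (∫ q in (0:ℝ)..X, p q) - ∑ n, C n (x n) := rfl
  have hSWS : SW C p xS = (∫ q in (0:ℝ)..Y, p q) - ∑ n, C n (xS n) := rfl
  rcases le_or_gt Q X with hQX | hXQ
  · -- saturated case
    have hpz : ∀ q, Q ≤ q → p q = 0 := by
      intro q hq
      have := hpanti (show Q ∈ Set.Ici 0 from hQ.le) (show q ∈ Set.Ici 0 from hQ.le.trans hq) hq
      exact le_antisymm (by linarith) (hpnn q (hQ.le.trans hq))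
    have hs : ∑ n, C n (x n) ≤ 0 := by
      apply Finset.sum_nonpos
      intro n _
      have h1 := hCle n
      have h2 := hC'le n
      rw [hpz X hQX] at h2
      nlinarith [mul_nonneg (neg_nonneg.2 hpl0) (sq_nonneg (x n))]
    have hIX : (∫ q in (0:ℝ)..Q, p q) ≤ ∫ q in (0:ℝ)..X, p q := by
      have := hInn Q X hQ.le hQX
      have := hII Q X hQ.le hX0'
      linarith
    have hIY : (∫ q in (0:ℝ)..Y, p q) ≤ ∫ q in (0:ℝ)..Q, p q := by
      rcases le_total Y Q with h | h
      · have := hInn Y Q hY0 h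
        have := hII Y Q hY0 hQ.le
        linarith
      · have h1 := hII Q Y hQ.le hY0
        have h2 := int_le hpc 0 0 0 hQ.le h (fun q h0 _ => by rw [hpz q h0]; simp)
        linarith
    have hs2 : 0 ≤ ∑ n, C n (xS n) := Finset.sum_nonneg fun n _ => hCnn n _ (hS0 n)
    have hp1 : 0 < SW C p xS := by linarith
    rw [le_div_iff₀ hp1]
    nlinarith
  · -- main case
    obtain ⟨c, hc⟩ : ∃ c, c = - pl X := ⟨_, rfl⟩
    obtain ⟨d, hd⟩ : ∃ d, d = - pl Q := ⟨_, rfl⟩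
    have hplX : pl X = -c := by linarith
    have hplQ' : pl Q = -d := by linarith
    rw [hplX] at htanX hpl0 hC'le hC'ge
    rw [hplQ'] at htanQ hplQ hμδ
    have hd0 : 0 < d := by linarith
    have hPd : d * (Q - X) ≤ p X := by
      have := htanQ X hX0' hXQ.le
      linarith
    have hc0 : 0 < c := by
      have h1 := htanX Q hQ.le
      rw [hpQ] at h1
      have h2 : 0 < d * (Q - X) := mul_pos hd0 (by linarith)
      by_contra hcon
      have : 0 ≤ -c * (Q - X) := mul_nonneg (by linarith) (by linarith)
      linarith
    have hcμ : c ≤ μ * d := by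
      have h1 := htanX 0 le_rfl
      have h2 := tan_right hconv le_rfl hpr0 hX0'
      have h3 : c * X ≤ (μ * d) * X := by nlinarith
      exact le_of_mul_le_mul_right h3 hX0
    have hchord : ∀ q, X ≤ q → q ≤ Q → p q ≤ p X + (-d) * (q - X) := by
      intro q h1 h2
      have hQX : 0 < Q - X := by linarith
      have := hconv.2 (show X ∈ Set.Ici 0 from hX0') (show Q ∈ Set.Ici 0 from hQ.le)
        (show 0 ≤ (Q - q) / (Q - X) from div_nonneg (by linarith) hQX.le)
        (show 0 ≤ (q - X) / (Q - X) from div_nonneg (by linarith) hQX.le)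
        (by field_simp; ring)
      simp only [smul_eq_mul] at this
      rw [hpQ, show (Q - q) / (Q - X) * X + (q - X) / (Q - X) * Q = q by field_simp; ring] at this
      have h3 : d * (q - X) ≤ p X * ((q - X) / (Q - X)) := by
        rw [← mul_div_assoc, le_div_iff₀ hQX]
        nlinarith [mul_le_mul_of_nonneg_right hPd (sub_nonneg.2 h1)]
      have h4 : (Q - q) / (Q - X) = 1 - (q - X) / (Q - X) := by field_simp; ring
      rw [h4] at this
      linarith
    have : Nonempty (Fin N) := ⟨⟨0, hN⟩⟩
    obtain ⟨k, hk⟩ := Finite.exists_max x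
    obtain ⟨a, haa⟩ : ∃ a, a = x k := ⟨_, rfl⟩
    rw [← haa] at hk
    have ha0 : 0 < a := by
      by_contra hcon
      have : X ≤ 0 := Finset.sum_nonpos fun n _ => (hk n).trans (not_lt.1 hcon)
      linarith
    have haX : a ≤ X := by
      rw [haa]; exact Finset.single_le_sum (fun n _ => hx0 n) (Finset.mem_univ k)
    obtain ⟨S, hS⟩ : ∃ S, S = ∑ n, (x n) ^ 2 := ⟨_, rfl⟩
    have haS : a ^ 2 ≤ S := by
      rw [haa, hS]
      exact Finset.single_le_sum (f := fun n => (x n) ^ 2) (fun n _ => sq_nonneg (x n))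
        (Finset.mem_univ k)
    obtain ⟨m, hm⟩ : ∃ m, m = p X - c * a := ⟨_, rfl⟩
    have hm0 : 0 ≤ m := by
      have h1 := hC'le k
      have h2 := hCle k
      have h3 := hCnn k (x k) (hx0 k)
      rw [← haa] at h1 h2 h3
      have : 0 * a ≤ m * a := by rw [hm]; nlinarith
      exact le_of_mul_le_mul_right this ha0
    have hmn : ∀ n, m ≤ C' n (x n) := by
      intro n
      have h1 := hC'ge n
      have h2 := mul_le_mul_of_nonneg_left (hk n) hc0.le
      linarith
    have hquad : ∀ t : ℝ, c * a * t + -d * t ^ 2 / 2 ≤ c ^ 2 * a ^ 2 / (2 * d) := by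
      intro t
      exact quad_bd hd0
    have hXQbd : ∀ Z, X ≤ Z → Z ≤ Q →
        (∫ q in X..Z, p q) - m * (Z - X) ≤ c ^ 2 * a ^ 2 / (2 * d) := by
      intro Z h1 h2
      have h3 := int_le hpc (p X) (-d) X hX0' h1 (fun q hq1 hq2 => hchord q hq1 (hq2.trans h2))
      have h4 := hquad (Z - X)
      rw [hm]
      linarith
    have hG : (∫ q in (0:ℝ)..Y, p q) - (∫ q in (0:ℝ)..X, p q) - m * (Y - X)
        ≤ c ^ 2 * a ^ 2 / (2 * d) := by
      rcases le_total X Y with h | h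
      · rcases le_total Y Q with h' | h'
        · have := hXQbd Y h h'
          have := hII X Y hX0' hY0
          linarith
        · have h1 := hXQbd Q hXQ.le le_rfl
          have h2 := hII X Q hX0' hQ.le
          have h3 := hII Q Y hQ.le hY0
          have h4 := int_le hpc 0 0 0 hQ.le h' (fun q h0 _ => by
            have := hpanti (show Q ∈ Set.Ici 0 from hQ.le)
              (show q ∈ Set.Ici 0 from hQ.le.trans h0) h0
            linarith)
          nlinarith [mul_nonneg hm0 (sub_nonneg.2 h')]
      · have h1 := int_ge hpc m 0 0 hY0 h (fun q h0 h1 => by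
          have := hpanti (show q ∈ Set.Ici 0 from hY0.trans h0) (show X ∈ Set.Ici 0 from hX0') h1
          nlinarith [mul_pos hc0 ha0])
        have h2 := hII Y X hY0 hX0'
        have h3 : 0 ≤ c ^ 2 * a ^ 2 / (2 * d) := by positivity
        linarith
    -- sums
    have hsumx : ∑ n, C' n (x n) * x n ≤ p X * X - c * S := by
      calc ∑ n, C' n (x n) * x n ≤ ∑ n, (p X * x n + -c * (x n) ^ 2) :=
            Finset.sum_le_sum fun n _ => hC'le n
        _ = p X * X - c * S := by
            rw [Finset.sum_add_distrib, ← Finset.mul_sum, ← Finset.mul_sum, ← hS]; ring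
    have hsumCx : ∑ n, C n (x n) ≤ p X * X - c * S :=
      (Finset.sum_le_sum fun n _ => hCle n).trans hsumx
    have hsumS : m * Y ≤ ∑ n, C' n (x n) * xS n := by
      rw [hYdef, Finset.mul_sum]
      exact Finset.sum_le_sum fun n _ => mul_le_mul_of_nonneg_right (hmn n) (hS0 n)
    have hsumCS : ∑ n, C n (x n) + (∑ n, C' n (x n) * xS n - ∑ n, C' n (x n) * x n)
        ≤ ∑ n, C n (xS n) := by
      rw [← Finset.sum_sub_distrib, ← Finset.sum_add_distrib]
      apply Finset.sum_le_sum
      intro n _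
      have := ctan (hC n) (hx0 n) (hS0 n)
      linarith
    have hIX : p X * X + c * X ^ 2 / 2 ≤ ∫ q in (0:ℝ)..X, p q := by
      have := int_ge hpc (p X) (-c) X le_rfl hX0' (fun q h0 _ => htanX q h0)
      nlinarith
    have hA : c * (X ^ 2 / 2 + S) ≤ SW C p x := by rw [hSWx]; linarith
    have hB : SW C p xS - SW C p x ≤ c ^ 2 * a ^ 2 / (2 * d) + c * a * X - c * S := by
      rw [hSWx, hSWS]
      have : m * X = p X * X - c * a * X := by rw [hm]; ring
      linarith
    have hB2 : c ^ 2 * a ^ 2 / (2 * d) ≤ c * μ * a ^ 2 / 2 := by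
      rw [div_le_iff₀ (by positivity)]
      nlinarith [mul_le_mul_of_nonneg_left hcμ (show 0 ≤ c * a ^ 2 by positivity)]
    have hkey := fbound_key hμ0 ha0 haX
    have hSpos : 0 < S := lt_of_lt_of_le (by positivity) haS
    have hpS : 0 < SW C p xS := by
      have : 0 < c * (X ^ 2 / 2 + S) := by positivity
      linarith
    rw [le_div_iff₀ hpS]
    have e1 : fbound μ * (SW C p xS - SW C p x)
        ≤ fbound μ * (c * μ * a ^ 2 / 2 + c * a * X - c * S) :=
      mul_le_mul_of_nonneg_left (by linarith) hF0.le
    have e2 : (1 - fbound μ) * (c * (X ^ 2 / 2 + S)) ≤ (1 - fbound μ) * SW C p x :=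
      mul_le_mul_of_nonneg_left hA (by linarith)
    have e3 := mul_le_mul_of_nonneg_left hkey (show 0 ≤ c / 2 by positivity)
    have e4 := mul_le_mul_of_nonneg_left haS hc0.le
    linarith

end
end

section
/- Suppose Assumptions 1–4 hold and the inverse demand function p is convex. Define s = inf{q ≥ 0 : p(q) = min_n C_n'(0)}. Then there exists a social optimum whose aggregate supply is at most s. -/
open Finset Set

noncomputable section

/-- There exists a social optimum whose aggregate supply is at most
`s = inf {q ≥ 0 : p q = minₙ Cₙ'(0)}`. -/
theorem social_optimum_supply_le_s {N : ℕ} (hN : 0 < N)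
    (C C' : Fin N → ℝ → ℝ) (p pl pr : ℝ → ℝ)
    (hC : ∀ n, CostAssumption (C n) (C' n))
    (hp : DemandAssumption p pl pr)
    (hA3 : ∃ R : ℝ, 0 < R ∧ ∀ n, p R ≤ C' n 0)
    (hA4 : ∃ n, C' n 0 < p 0)
    (hconv : ConvexOn ℝ (Set.Ici 0) p)
    (s : ℝ) (hs : s = sInf {q : ℝ | 0 ≤ q ∧ p q = ⨅ n, C' n 0}) :
    ∃ xS : Fin N → ℝ, SocialOptimum C p xS ∧ (∑ n, xS n) ≤ s := by
  obtain ⟨hpc, hp0, hpa, -, -⟩ := hp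
  haveI : Nonempty (Fin N) := ⟨⟨0, hN⟩⟩
  set c : ℝ := ⨅ n, C' n 0 with hc
  have hbdd : BddBelow (Set.range fun n => C' n 0) := (Set.finite_range _).bddBelow
  have hcle : ∀ n, c ≤ C' n 0 := fun n => ciInf_le hbdd n
  have hc0 : c < p 0 := by
    obtain ⟨n, hn⟩ := hA4
    exact lt_of_le_of_lt (hcle n) hn
  obtain ⟨R, hR0, hR⟩ := hA3
  have hRc : p R ≤ c := le_ciInf hR
  -- the set is nonempty and `s` belongs to it
  have hsmem : 0 ≤ s ∧ p s = c := by
    have hne : {q : ℝ | 0 ≤ q ∧ p q = c}.Nonempty := by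
      have := intermediate_value_Icc' hR0.le (hpc.mono Set.Icc_subset_Ici_self)
      obtain ⟨q, hq, hq'⟩ := this ⟨hRc, hc0.le⟩
      exact ⟨q, hq.1, hq'⟩
    have hclosed : IsClosed {q : ℝ | 0 ≤ q ∧ p q = c} := by
      have := hpc.preimage_isClosed_of_isClosed isClosed_Ici (isClosed_singleton (x := c))
      exact this
    have := hclosed.csInf_mem hne ⟨0, fun q hq => hq.1⟩
    rw [← hs] at this
    exact this
  obtain ⟨hs0, hps⟩ := hsmem
  have hint : ∀ a b : ℝ, 0 ≤ a → 0 ≤ b → IntervalIntegrable p MeasureTheory.volume a b := by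
    intro a b ha hb
    apply ContinuousOn.intervalIntegrable
    apply hpc.mono
    intro q hq
    exact le_trans (le_min ha hb) hq.1
  -- compact maximization
  let K : Set (Fin N → ℝ) := {x | (∀ n, 0 ≤ x n) ∧ ∑ n, x n ≤ s}
  have hKc : IsCompact K := by
    apply IsCompact.of_isClosed_subset (isCompact_Icc (a := (0 : Fin N → ℝ)) (b := fun _ => s))
    · have h1 : IsClosed {x : Fin N → ℝ | ∀ n, 0 ≤ x n} := by
        simp only [Set.setOf_forall]
        exact isClosed_iInter fun n => isClosed_le continuous_const (continuous_apply n)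
      have h2 : IsClosed {x : Fin N → ℝ | ∑ n, x n ≤ s} :=
        isClosed_le (by fun_prop) continuous_const
      exact h1.inter h2
    · rintro x ⟨hx, hxs⟩
      refine ⟨fun n => hx n, fun n => ?_⟩
      exact (Finset.single_le_sum (fun i _ => hx i) (Finset.mem_univ n)).trans hxs
  have hKne : K.Nonempty := ⟨0, by simp [K, hs0]⟩
  have hcont : ContinuousOn (SW C p) K := by
    unfold SW
    apply ContinuousOn.sub
    · have h := intervalIntegral.continuousOn_primitive_interval' (hint 0 s le_rfl hs0)
        (Set.left_mem_uIcc)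
      refine h.comp (f := fun x : Fin N → ℝ => ∑ n, x n) (by fun_prop) ?_
      rintro x ⟨hx, hxs⟩
      rw [Set.uIcc_of_le hs0]
      exact ⟨Finset.sum_nonneg fun i _ => hx i, hxs⟩
    · apply continuousOn_finsetSum
      intro n _
      exact (hC n).2.1.comp (by fun_prop) (fun x hx => hx.1 n)
  obtain ⟨x, hxK, hxmax⟩ := hKc.exists_isMaxOn hKne hcont
  refine ⟨x, ⟨hxK.1, fun y hy => ?_⟩, hxK.2⟩
  rcases le_or_gt (∑ n, y n) s with hY | hY
  · exact hxmax ⟨hy, hY⟩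
  set Y := ∑ n, y n with hYdef
  have hY0 : 0 < Y := lt_of_le_of_lt hs0 hY
  set t := s / Y with ht
  have ht0 : 0 ≤ t := by positivity
  have ht1 : t ≤ 1 := (div_le_one hY0).2 hY.le
  have htY : t * Y = s := div_mul_cancel₀ _ hY0.ne'
  have hsum : ∑ n, t * y n = s := by rw [← Finset.mul_sum, ← hYdef, htY]
  have hmem : (fun n => t * y n) ∈ K := ⟨fun n => mul_nonneg ht0 (hy n), hsum.le⟩
  refine le_trans ?_ (hxmax hmem)
  simp only [SW, Set.mem_setOf_eq]
  rw [hsum, ← hYdef]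
  have hadd := intervalIntegral.integral_add_adjacent_intervals (hint 0 s le_rfl hs0)
    (hint s Y hs0 hY0.le)
  have hI : ∫ q in s..Y, p q ≤ c * (Y - s) := by
    have := intervalIntegral.integral_mono_on hY.le (hint s Y hs0 hY0.le)
      (intervalIntegrable_const (c := c)) (fun q hq => by
        rw [← hps]; exact hpa hs0 (hs0.trans hq.1) hq.1)
    rw [intervalIntegral.integral_const, smul_eq_mul] at this
    linarith
  have hcost : ∑ n, C n (t * y n) + c * (Y - s) ≤ ∑ n, C n (y n) := by
    have : c * (Y - s) = ∑ n, c * (1 - t) * y n := by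
      rw [← Finset.mul_sum, ← hYdef, ← htY]; ring
    rw [this, ← Finset.sum_add_distrib]
    apply Finset.sum_le_sum
    intro n _
    obtain ⟨hcv, -, -, -, -, hd, hz⟩ := hC n
    have htan : C' n 0 * y n ≤ C n (y n) := by
      rcases (hy n).eq_or_lt with h | h
      · rw [← h]; simp [hz]
      · have := hcv.le_slope_of_hasDerivWithinAt Set.self_mem_Ici (hy n) h hd
        rw [slope_def_field, hz, sub_zero, sub_zero, le_div_iff₀ h] at this
        exact this
    have hscale : C n (t * y n) ≤ t * C n (y n) := by
      have := hcv.2 (Set.self_mem_Ici : (0:ℝ) ∈ Set.Ici 0) (hy n) (sub_nonneg.2 ht1) ht0 (by ring)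
      simpa [hz] using this
    have h1 : c * y n ≤ C n (y n) := (mul_le_mul_of_nonneg_right (hcle n) (hy n)).trans htan
    have h2 := mul_le_mul_of_nonneg_left h1 (sub_nonneg.2 ht1)
    linarith
  linarith

end
end
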